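/- (Homogeneous Korn inequality on a periodic half-strip.) Let 1 < p < ∞. There exists a constant C > 0, depending only on p, such that for every a ∈ ℝ and every map u : ℝ² → ℝ² which is continuously differentiable, 1-periodic in its first variable, and satisfies ∫_{H_a} ‖∇u‖_F^p dy < ∞ where H_a = (0,1) × (a, +∞), one has ∫_{H_a} ‖∇u(y)‖_F^p dy ≤ C ∫_{H_a} ‖Du(y)‖_F^p dy. -/

import Mathlib

open MeasureTheory Matrix

/-- The Jacobian matrix of a map `u : ℝ² → ℝ²`: entry `(i, j)` is `∂uᵢ/∂yⱼ`. -/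
noncomputable def jacMat (u : ℝ × ℝ → ℝ × ℝ) (y : ℝ × ℝ) : Matrix (Fin 2) (Fin 2) ℝ :=
  !![(fderiv ℝ u y (1, 0)).1, (fderiv ℝ u y (0, 1)).1;
     (fderiv ℝ u y (1, 0)).2, (fderiv ℝ u y (0, 1)).2]

/-- The symmetric part `(A + Aᵀ)/2` of a 2×2 matrix. -/
noncomputable def symPart (A : Matrix (Fin 2) (Fin 2) ℝ) : Matrix (Fin 2) (Fin 2) ℝ :=
  (1 / 2 : ℝ) • (A + Aᵀ)

/-- The Frobenius norm of a 2×2 matrix. -/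
noncomputable def frobNorm (A : Matrix (Fin 2) (Fin 2) ℝ) : ℝ :=
  Real.sqrt (∑ i, ∑ j, (A i j) ^ 2)

section Preliminaries

open Set Filter Topology

section

variable {E : Type*} [NormedAddCommGroup E]

lemma setIntegral_box_eq_iterated [NormedSpace ℝ E] {b d : ℝ} (hbd : b ≤ d) {g : ℝ × ℝ → E}
    (hg : Continuous g) :
    ∫ z in Icc (0 : ℝ) 1 ×ˢ Icc b d, g z = ∫ x in (0 : ℝ)..1, ∫ y in b..d, g (x, y) := by
  rw [Measure.volume_eq_prod, setIntegral_prod _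
    (hg.continuousOn.integrableOn_compact (isCompact_Icc.prod isCompact_Icc)),
    intervalIntegral.integral_of_le zero_le_one, integral_Icc_eq_integral_Ioc]
  congr 1 with x
  rw [intervalIntegral.integral_of_le hbd, integral_Icc_eq_integral_Ioc]

lemma setIntegral_box_eq_iterated_swap [NormedSpace ℝ E] {b d : ℝ} (hbd : b ≤ d) {g : ℝ × ℝ → E}
    (hg : Continuous g) :
    ∫ z in Icc (0 : ℝ) 1 ×ˢ Icc b d, g z = ∫ y in b..d, ∫ x in (0 : ℝ)..1, g (x, y) := by
  rw [setIntegral_box_eq_iterated hbd hg]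
  simp_rw [intervalIntegral.integral_of_le hbd, intervalIntegral.integral_of_le zero_le_one]
  refine integral_integral_swap ?_
  rw [Measure.prod_restrict]
  exact (hg.continuousOn.integrableOn_compact (isCompact_Icc.prod isCompact_Icc)).mono_set
    (prod_mono Ioc_subset_Icc_self Ioc_subset_Icc_self)

lemma Continuous.integrableOn_box {b d : ℝ} {g : ℝ × ℝ → E} (hg : Continuous g) :
    IntegrableOn g (Icc (0 : ℝ) 1 ×ˢ Icc b d) :=
  hg.continuousOn.integrableOn_compact (isCompact_Icc.prod isCompact_Icc)

/-- The integral of a periodic supersolution of the heat equation is nondecreasing in time. -/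
lemma setIntegral_le_of_supercaloric {b d T : ℝ} (hbd : b ≤ d) (hT : 0 ≤ T)
    {V Vt Vx Vxx Vy Vyy : ℝ → ℝ → ℝ → ℝ}
    (cV : Continuous fun z : ℝ × ℝ × ℝ => V z.1 z.2.1 z.2.2)
    (cVt : Continuous fun z : ℝ × ℝ × ℝ => Vt z.1 z.2.1 z.2.2)
    (cVxx : Continuous fun z : ℝ × ℝ × ℝ => Vxx z.1 z.2.1 z.2.2)
    (cVyy : Continuous fun z : ℝ × ℝ × ℝ => Vyy z.1 z.2.1 z.2.2)
    (ht : ∀ t x y, HasDerivAt (fun s => V s x y) (Vt t x y) t)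
    (hxx : ∀ t x y, HasDerivAt (fun s => Vx t s y) (Vxx t x y) x)
    (hyy : ∀ t x y, HasDerivAt (fun s => Vy t x s) (Vyy t x y) y)
    (px : ∀ t y, Vx t 1 y = Vx t 0 y) (py : ∀ t x, Vy t x d = Vy t x b)
    (h : ∀ t x y, Vxx t x y + Vyy t x y ≤ Vt t x y) :
    ∫ z in Icc (0 : ℝ) 1 ×ˢ Icc b d, V 0 z.1 z.2 ≤
      ∫ z in Icc (0 : ℝ) 1 ×ˢ Icc b d, V T z.1 z.2 := by
  have c2 : ∀ {G : ℝ → ℝ → ℝ → ℝ}, (Continuous fun z : ℝ × ℝ × ℝ => G z.1 z.2.1 z.2.2) →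
      ∀ t, Continuous fun z : ℝ × ℝ => G t z.1 z.2 := fun hG t =>
    hG.comp (by fun_prop : Continuous fun z : ℝ × ℝ => (t, z.1, z.2))
  have cx : ∀ {G : ℝ → ℝ → ℝ → ℝ}, (Continuous fun z : ℝ × ℝ × ℝ => G z.1 z.2.1 z.2.2) →
      ∀ t y, Continuous fun x => G t x y := fun hG t y =>
    hG.comp (by fun_prop : Continuous fun x : ℝ => (t, x, y))
  have cy : ∀ {G : ℝ → ℝ → ℝ → ℝ}, (Continuous fun z : ℝ × ℝ × ℝ => G z.1 z.2.1 z.2.2) →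
      ∀ t x, Continuous fun y => G t x y := fun hG t x =>
    hG.comp (by fun_prop : Continuous fun y : ℝ => (t, x, y))
  have ct : ∀ {G : ℝ → ℝ → ℝ → ℝ}, (Continuous fun z : ℝ × ℝ × ℝ => G z.1 z.2.1 z.2.2) →
      ∀ x y, Continuous fun t => G t x y := fun hG x y =>
    hG.comp (by fun_prop : Continuous fun t : ℝ => (t, x, y))
  rw [← sub_nonneg, ← integral_sub (c2 cV T).integrableOn_box (c2 cV 0).integrableOn_box]
  have e1 : ∀ z : ℝ × ℝ, V T z.1 z.2 - V 0 z.1 z.2 = ∫ t in Ioc 0 T, Vt t z.1 z.2 := by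
    intro z
    rw [← intervalIntegral.integral_of_le hT, intervalIntegral.integral_eq_sub_of_hasDerivAt
      (fun t _ => ht t z.1 z.2) ((ct cVt z.1 z.2).intervalIntegrable _ _)]
  simp_rw [e1]
  rw [integral_integral_swap]
  · refine integral_nonneg fun t => ?_
    have zx : ∫ z in Icc (0 : ℝ) 1 ×ˢ Icc b d, Vxx t z.1 z.2 = 0 := by
      rw [setIntegral_box_eq_iterated_swap hbd (c2 cVxx t)]
      simp_rw [intervalIntegral.integral_eq_sub_of_hasDerivAt (fun x _ => hxx t x _)
        ((cx cVxx t _).intervalIntegrable _ _), px]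
      simp
    have zy : ∫ z in Icc (0 : ℝ) 1 ×ˢ Icc b d, Vyy t z.1 z.2 = 0 := by
      rw [setIntegral_box_eq_iterated hbd (c2 cVyy t)]
      simp_rw [intervalIntegral.integral_eq_sub_of_hasDerivAt (fun x _ => hyy t _ x)
        ((cy cVyy t _).intervalIntegrable _ _), py]
      simp
    have := integral_mono (μ := volume.restrict (Icc (0 : ℝ) 1 ×ˢ Icc b d))
      ((c2 cVxx t).integrableOn_box.add (c2 cVyy t).integrableOn_box)
      (c2 cVt t).integrableOn_box (fun z => h t z.1 z.2)
    simp only [Pi.add_apply] at this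
    rw [integral_add (c2 cVxx t).integrableOn_box (c2 cVyy t).integrableOn_box, zx, zy] at this
    simpa using this
  · rw [Measure.prod_restrict]
    have c : Continuous (Function.uncurry fun (z : ℝ × ℝ) (t : ℝ) => Vt t z.1 z.2) :=
      cVt.comp (by fun_prop : Continuous fun z : (ℝ × ℝ) × ℝ => (z.2, z.1.1, z.1.2))
    exact (c.continuousOn.integrableOn_compact
      ((isCompact_Icc.prod isCompact_Icc).prod isCompact_Icc)).mono_set
      (prod_mono_right Ioc_subset_Icc_self)

end

section PowerOfQuadratic

variable {ι : Type*} [Fintype ι]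

/-- The quadratic expression `ε + ∑ κᵢ Fᵢ²`. -/
def regSq (κ : ι → ℝ) (ε : ℝ) (F : ι → ℝ) : ℝ := ε + ∑ i, κ i * F i ^ 2

/-- The second-order part of the second derivative of `regSq κ ε F ^ q` along a curve with
velocity `G`. -/
noncomputable def powHess (κ : ι → ℝ) (ε q : ℝ) (F G : ι → ℝ) : ℝ :=
  2 * q * regSq κ ε F ^ (q - 1) * ∑ i, κ i * G i ^ 2 +
    4 * q * (q - 1) * regSq κ ε F ^ (q - 2) * (∑ i, κ i * (F i * G i)) ^ 2

/-- The first derivative of `regSq κ ε F ^ q` along a curve with velocity `G`. -/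
noncomputable def powGrad (κ : ι → ℝ) (ε q : ℝ) (F G : ι → ℝ) : ℝ :=
  2 * q * regSq κ ε F ^ (q - 1) * ∑ i, κ i * (F i * G i)

variable {κ : ι → ℝ} {ε q : ℝ}

lemma regSq_pos (hκ : ∀ i, 0 ≤ κ i) (hε : 0 < ε) (F : ι → ℝ) : 0 < regSq κ ε F := by
  have : 0 ≤ ∑ i, κ i * F i ^ 2 := Finset.sum_nonneg fun i _ => mul_nonneg (hκ i) (sq_nonneg _)
  unfold regSq; linarith

lemma hasDerivAt_regSq {F G : ℝ → ι → ℝ} {x : ℝ}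
    (hF : ∀ i, HasDerivAt (fun s => F s i) (G x i) x) :
    HasDerivAt (fun s => regSq κ ε (F s)) (2 * ∑ i, κ i * (F x i * G x i)) x := by
  unfold regSq
  have := HasDerivAt.fun_sum (u := Finset.univ) fun i _ => ((hF i).pow 2).const_mul (κ i)
  refine (this.const_add ε).congr_deriv ?_
  rw [Finset.mul_sum]
  exact Finset.sum_congr rfl fun i _ => by push_cast; ring

lemma hasDerivAt_regSq_rpow (hκ : ∀ i, 0 ≤ κ i) (hε : 0 < ε) {F G : ℝ → ι → ℝ} {x : ℝ}
    (hF : ∀ i, HasDerivAt (fun s => F s i) (G x i) x) :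
    HasDerivAt (fun s => regSq κ ε (F s) ^ q) (powGrad κ ε q (F x) (G x)) x := by
  refine ((hasDerivAt_regSq hF).rpow_const (Or.inl (regSq_pos hκ hε _).ne')).congr_deriv ?_
  unfold powGrad; ring

lemma hasDerivAt_powGrad (hκ : ∀ i, 0 ≤ κ i) (hε : 0 < ε) {F G H : ℝ → ι → ℝ} {x : ℝ}
    (hF : ∀ i, HasDerivAt (fun s => F s i) (G x i) x)
    (hG : ∀ i, HasDerivAt (fun s => G s i) (H x i) x) :
    HasDerivAt (fun s => powGrad κ ε q (F s) (G s))
      (powHess κ ε q (F x) (G x) + powGrad κ ε q (F x) (H x)) x := by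
  have h1 := (hasDerivAt_regSq (κ := κ) (ε := ε) hF).rpow_const (p := q - 1)
    (Or.inl (regSq_pos hκ hε _).ne')
  have h2 : HasDerivAt (fun s => ∑ i, κ i * (F s i * G s i))
      (∑ i, κ i * G x i ^ 2 + ∑ i, κ i * (F x i * H x i)) x := by
    refine (HasDerivAt.fun_sum (u := Finset.univ) fun i _ =>
      ((hF i).mul (hG i)).const_mul (κ i)).congr_deriv ?_
    rw [← Finset.sum_add_distrib]
    exact Finset.sum_congr rfl fun i _ => by ring
  refine ((h1.const_mul (2 * q)).mul h2).congr_deriv ?_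
  unfold powHess powGrad
  rw [show q - 1 - 1 = q - 2 by ring]
  ring

lemma powHess_bounds (hκ : ∀ i, 0 ≤ κ i) (hε : 0 < ε) (hq : 0 < q) (F G : ι → ℝ) :
    2 * q * min 1 (2 * q - 1) * (regSq κ ε F ^ (q - 1) * ∑ i, κ i * G i ^ 2) ≤
        powHess κ ε q F G ∧
      powHess κ ε q F G ≤
        2 * q * max 1 (2 * q - 1) * (regSq κ ε F ^ (q - 1) * ∑ i, κ i * G i ^ 2) := by
  have hS := regSq_pos hκ hε F
  set S := regSq κ ε F with hSd
  set Q := ∑ i, κ i * G i ^ 2 with hQ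
  set X := ∑ i, κ i * (F i * G i) with hX
  have hQ0 : 0 ≤ Q := Finset.sum_nonneg fun i _ => mul_nonneg (hκ i) (sq_nonneg _)
  have hcs : X ^ 2 ≤ S * Q := by
    have h := Finset.sum_sq_le_sum_mul_sum_of_sq_le_mul Finset.univ
      (r := fun i => κ i * (F i * G i)) (f := fun i => κ i * F i ^ 2)
      (g := fun i => κ i * G i ^ 2)
      (fun i _ => mul_nonneg (hκ i) (sq_nonneg _)) (fun i _ => mul_nonneg (hκ i) (sq_nonneg _))
      (fun i _ => le_of_eq (by ring))
    refine h.trans (mul_le_mul_of_nonneg_right ?_ hQ0)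
    rw [hSd]; unfold regSq; linarith
  have hS1 : S ^ (q - 1) = S ^ (q - 2) * S := by
    rw [← Real.rpow_add_one hS.ne']; ring_nf
  have hY0 : 0 ≤ S ^ (q - 2) * X ^ 2 := by positivity
  have hY1 : S ^ (q - 2) * X ^ 2 ≤ S ^ (q - 1) * Q := by
    rw [hS1, mul_assoc]
    exact mul_le_mul_of_nonneg_left hcs (by positivity)
  have hP : powHess κ ε q F G =
      2 * q * (S ^ (q - 1) * Q + (2 * q - 2) * (S ^ (q - 2) * X ^ 2)) := by
    unfold powHess; rw [← hSd, ← hQ, ← hX]; ring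
  rw [hP, mul_assoc (2 * q), mul_assoc (2 * q)]
  generalize S ^ (q - 2) * X ^ 2 = Y at *
  generalize S ^ (q - 1) * Q = Z at *
  constructor <;> refine mul_le_mul_of_nonneg_left ?_ (by positivity)
  · rcases le_total 1 (2 * q - 1) with h | h
    · rw [min_eq_left h]; nlinarith
    · rw [min_eq_right h]; nlinarith
  · rcases le_total 1 (2 * q - 1) with h | h
    · rw [max_eq_right h]; nlinarith
    · rw [max_eq_left h]; nlinarith

end PowerOfQuadratic

section HeatSum

variable {ι : Type*}

/-- The real part of a finite sum of plane waves evolving by the heat equation. -/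
noncomputable def heatSum (J : Finset ι) (α β : ι → ℝ) (c : ι → ℂ) (t x y : ℝ) : ℝ :=
  (∑ j ∈ J, c j * Complex.exp
    (-((α j : ℂ) ^ 2 + (β j : ℂ) ^ 2) * t + Complex.I * (α j * x + β j * y))).re

variable {J : Finset ι} {α β : ι → ℝ}

@[fun_prop]
lemma continuous_heatSum (c : ι → ℂ) :
    Continuous fun z : ℝ × ℝ × ℝ => heatSum J α β c z.1 z.2.1 z.2.2 := by
  unfold heatSum
  exact Complex.continuous_re.comp (by fun_prop)

lemma hasDerivAt_re_sum_exp {c m : ι → ℂ} {g : ι → ℝ → ℂ} {x : ℝ}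
    (hg : ∀ j, HasDerivAt (g j) (m j) x) :
    HasDerivAt (fun s => (∑ j ∈ J, c j * Complex.exp (g j s)).re)
      (∑ j ∈ J, m j * c j * Complex.exp (g j x)).re x := by
  have := HasDerivAt.fun_sum (u := J) fun j _ => ((hg j).cexp).const_mul (c j)
  have h2 := Complex.reCLM.hasFDerivAt.comp_hasDerivAt x this
  refine h2.congr_deriv ?_
  simp only [Complex.reCLM_apply]
  congr 1
  exact Finset.sum_congr rfl fun j _ => by ring

lemma hasDerivAt_heatSum_time (c : ι → ℂ) (t x y : ℝ) :
    HasDerivAt (fun s => heatSum J α β c s x y)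
      (heatSum J α β (fun j => -((α j : ℂ) ^ 2 + (β j : ℂ) ^ 2) * c j) t x y) t := by
  refine hasDerivAt_re_sum_exp fun j => ?_
  have := (Complex.ofRealCLM.hasDerivAt (x := t)).const_mul (-((α j : ℂ) ^ 2 + (β j : ℂ) ^ 2))
  simpa using this.add_const (Complex.I * (α j * x + β j * y))

lemma hasDerivAt_heatSum_fst (c : ι → ℂ) (t x y : ℝ) :
    HasDerivAt (fun s => heatSum J α β c t s y)
      (heatSum J α β (fun j => Complex.I * α j * c j) t x y) x := by
  refine hasDerivAt_re_sum_exp fun j => ?_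
  have := ((((Complex.ofRealCLM.hasDerivAt (x := x)).const_mul (α j : ℂ)).add_const
    ((β j : ℂ) * y)).const_mul Complex.I).const_add (-((α j : ℂ) ^ 2 + (β j : ℂ) ^ 2) * t)
  simpa using this

lemma hasDerivAt_heatSum_snd (c : ι → ℂ) (t x y : ℝ) :
    HasDerivAt (fun s => heatSum J α β c t x s)
      (heatSum J α β (fun j => Complex.I * β j * c j) t x y) y := by
  refine hasDerivAt_re_sum_exp fun j => ?_
  have := ((((Complex.ofRealCLM.hasDerivAt (x := y)).const_mul (β j : ℂ)).const_add
    ((α j : ℂ) * x)).const_mul Complex.I).const_add (-((α j : ℂ) ^ 2 + (β j : ℂ) ^ 2) * t)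
  simpa using this

lemma heatSum_periodic_fst (hα : ∀ j, Complex.exp (Complex.I * α j) = 1) (c : ι → ℂ)
    (t y : ℝ) : heatSum J α β c t 1 y = heatSum J α β c t 0 y := by
  unfold heatSum
  congr 1
  refine Finset.sum_congr rfl fun j _ => ?_
  rw [show -((α j : ℂ) ^ 2 + (β j : ℂ) ^ 2) * t + Complex.I * (α j * (1 : ℝ) + β j * y) =
    -((α j : ℂ) ^ 2 + (β j : ℂ) ^ 2) * t + Complex.I * (α j * (0 : ℝ) + β j * y) +
      Complex.I * α j by push_cast; ring, Complex.exp_add _ (Complex.I * α j), hα, mul_one]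

lemma heatSum_periodic_snd {b d : ℝ}
    (hβ : ∀ j, Complex.exp (Complex.I * (β j * (d - b))) = 1) (c : ι → ℂ)
    (t x : ℝ) : heatSum J α β c t x d = heatSum J α β c t x b := by
  unfold heatSum
  congr 1
  refine Finset.sum_congr rfl fun j _ => ?_
  rw [show -((α j : ℂ) ^ 2 + (β j : ℂ) ^ 2) * t + Complex.I * (α j * x + β j * d) =
    -((α j : ℂ) ^ 2 + (β j : ℂ) ^ 2) * t + Complex.I * (α j * x + β j * b) +
      Complex.I * (β j * (d - b)) by ring,
    Complex.exp_add _ (Complex.I * (β j * (d - b))), hβ, mul_one]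

lemma heatSum_add (c c' : ι → ℂ) (t x y : ℝ) :
    heatSum J α β (fun j => c j + c' j) t x y =
      heatSum J α β c t x y + heatSum J α β c' t x y := by
  unfold heatSum
  rw [← Complex.add_re, ← Finset.sum_add_distrib]
  simp_rw [add_mul]

lemma heatSum_sub (c c' : ι → ℂ) (t x y : ℝ) :
    heatSum J α β (fun j => c j - c' j) t x y =
      heatSum J α β c t x y - heatSum J α β c' t x y := by
  unfold heatSum
  rw [← Complex.sub_re, ← Finset.sum_sub_distrib]
  simp_rw [sub_mul]

lemma heatSum_const_mul (r : ℝ) (c : ι → ℂ) (t x y : ℝ) :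
    heatSum J α β (fun j => r * c j) t x y = r * heatSum J α β c t x y := by
  unfold heatSum
  rw [← Complex.re_ofReal_mul, Finset.mul_sum]
  simp_rw [mul_assoc]

lemma abs_heatSum_le (c : ι → ℂ) {t : ℝ} (ht : 0 ≤ t) (x y : ℝ) :
    |heatSum J α β c t x y| ≤ ∑ j ∈ J, ‖c j‖ := by
  refine (Complex.abs_re_le_norm _).trans ((norm_sum_le _ _).trans ?_)
  refine Finset.sum_le_sum fun j _ => ?_
  rw [norm_mul, Complex.norm_exp]
  refine mul_le_of_le_one_right (norm_nonneg _) (Real.exp_le_one_iff.2 ?_)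
  norm_cast
  simp only [Complex.add_re, Complex.ofReal_re, Complex.mul_re, Complex.I_re, Complex.I_im,
    Complex.ofReal_im, zero_mul, sub_zero, add_zero, mul_zero]
  nlinarith [mul_nonneg (add_nonneg (sq_nonneg (α j)) (sq_nonneg (β j))) ht]

lemma tendsto_heatSum_atTop (c : ι → ℂ) (hc : ∀ j ∈ J, α j = 0 → β j = 0 → c j = 0)
    (x y : ℝ) : Tendsto (fun t => heatSum J α β c t x y) atTop (𝓝 0) := by
  unfold heatSum
  rw [show (0 : ℝ) = (∑ j ∈ J, (0 : ℂ)).re by simp]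
  refine (Complex.continuous_re.tendsto _).comp (tendsto_finsetSum _ fun j hj => ?_)
  by_cases h0 : α j = 0 ∧ β j = 0
  · simp [hc j hj h0.1 h0.2]
  · have hpos : 0 < α j ^ 2 + β j ^ 2 := by
      rcases not_and_or.1 h0 with h | h <;> positivity
    rw [← mul_zero (c j)]
    refine Tendsto.const_mul _ (tendsto_zero_iff_norm_tendsto_zero.2 ?_)
    have h1 : Tendsto (fun t : ℝ => Real.exp (-((α j ^ 2 + β j ^ 2) * t))) atTop (𝓝 0) :=
      Real.tendsto_exp_neg_atTop_nhds_zero.comp (tendsto_id.const_mul_atTop hpos)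
    refine h1.congr fun t => ?_
    rw [Complex.norm_exp]
    congr 1
    norm_cast
    simp only [Complex.add_re, Complex.ofReal_re, Complex.mul_re, Complex.I_re, Complex.I_im,
      Complex.ofReal_im, zero_mul, sub_zero, add_zero, mul_zero]
    ring

end HeatSum

lemma exists_korn_weights {q : ℝ} (hq : 1 / 2 < q) :
    ∃ a r Λ : ℝ, 0 < a ∧ a ≤ 1 ∧ 0 < r ∧
      (∀ S S' : ℝ, 0 < S → a * S ≤ S' → S' ≤ S → S' ^ (q - 1) ≤ Λ * S ^ (q - 1)) ∧
      2 * max 1 (2 * q - 1) * Λ * (8 + a * r) ≤ min 1 (2 * q - 1) * r := by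
  set m := min 1 (2 * q - 1) with hm
  set M := max 1 (2 * q - 1) with hM
  have hm0 : 0 < m := lt_min one_pos (by linarith)
  have hM0 : 0 < M := lt_of_lt_of_le one_pos (le_max_left _ _)
  have ht : Tendsto (fun a : ℝ => 2 * M * max a (a ^ q)) (𝓝[>] 0) (𝓝 0) := by
    have h1 : Tendsto (fun a : ℝ => a ^ q) (𝓝 0) (𝓝 0) := by
      simpa [Real.zero_rpow (by linarith : q ≠ 0)] using
        (Real.continuousAt_rpow_const 0 q (Or.inr (by linarith))).tendsto
    have h2 := ((tendsto_id (x := 𝓝 (0 : ℝ))).max h1).const_mul (2 * M)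
    simp only [id, max_self, mul_zero] at h2
    exact h2.mono_left nhdsWithin_le_nhds
  have h1 : ∀ᶠ a : ℝ in 𝓝[>] 0, a ≤ 1 := nhdsWithin_le_nhds (ge_mem_nhds one_pos)
  obtain ⟨a, ⟨ha1, ha⟩, ha0⟩ := (((ht.eventually (ge_mem_nhds (half_pos hm0))).and h1).and
    self_mem_nhdsWithin).exists
  have ha0 : 0 < a := ha0
  set Λ := max 1 (a ^ (q - 1)) with hΛ
  have hΛ0 : 0 < Λ := lt_of_lt_of_le one_pos (le_max_left _ _)
  have hΛa : Λ * a = max a (a ^ q) := by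
    rw [hΛ, max_mul_of_nonneg _ _ ha0.le, one_mul, ← Real.rpow_add_one ha0.ne']
    ring_nf
  refine ⟨a, 32 * M * Λ / m, Λ, ha0, ha, by positivity, ?_, ?_⟩
  · intro S S' hS h1 h2
    have hS' : 0 < S' := lt_of_lt_of_le (by positivity) h1
    rcases le_total 1 q with h | h
    · refine (Real.rpow_le_rpow hS'.le h2 (by linarith)).trans ?_
      exact le_mul_of_one_le_left (by positivity) (le_max_left _ _)
    · refine (Real.rpow_le_rpow_of_nonpos (by positivity) h1 (by linarith)).trans ?_
      rw [Real.mul_rpow ha0.le hS.le]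
      exact mul_le_mul_of_nonneg_right (le_max_right _ _) (by positivity)
  · have e1 : 2 * M * Λ * (8 + a * (32 * M * Λ / m)) =
        16 * M * Λ + (2 * M * (Λ * a)) * (32 * M * Λ / m) := by ring
    have e2 : m * (32 * M * Λ / m) = 32 * M * Λ := by field_simp
    rw [e1, hΛa, e2]
    have h3 : 2 * M * max a (a ^ q) * (32 * M * Λ / m) ≤ m / 2 * (32 * M * Λ / m) :=
      mul_le_mul_of_nonneg_right ha1 (by positivity)
    have e4 : m / 2 * (32 * M * Λ / m) = 16 * M * Λ := by field_simp; norm_num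
    linarith

/-- Coefficients of the quadratic form `w² + s (e₁² + e₂² + e₃²)`. -/
def kornWeight (s : ℝ) : Fin 4 → ℝ := ![1, s, s, s]

lemma kornWeight_nonneg {s : ℝ} (hs : 0 ≤ s) (i : Fin 4) : 0 ≤ kornWeight s i := by
  fin_cases i <;> simp [kornWeight, hs]

lemma regSq_kornWeight (s ε : ℝ) (F : Fin 4 → ℝ) :
    regSq (kornWeight s) ε F = ε + (F 0 ^ 2 + s * (F 1 ^ 2 + F 2 ^ 2 + F 3 ^ 2)) := by
  simp [regSq, kornWeight, Fin.sum_univ_four]; ring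

lemma two_mul_powHess_le {q a r Λ ε : ℝ} (hq : 1 / 2 < q) (ha : 0 < a) (ha1 : a ≤ 1)
    (hr : 0 < r) (hε : 0 < ε)
    (hΛ : ∀ S S' : ℝ, 0 < S → a * S ≤ S' → S' ≤ S → S' ^ (q - 1) ≤ Λ * S ^ (q - 1))
    (hm : 2 * max 1 (2 * q - 1) * Λ * (8 + a * r) ≤ min 1 (2 * q - 1) * r)
    {F G H : Fin 4 → ℝ}
    (hG : G 0 ^ 2 + H 0 ^ 2 ≤ 8 * ((G 1 ^ 2 + G 2 ^ 2 + G 3 ^ 2) +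
      (H 1 ^ 2 + H 2 ^ 2 + H 3 ^ 2))) :
    2 * (powHess (kornWeight (a * r)) ε q F G + powHess (kornWeight (a * r)) ε q F H) ≤
      powHess (kornWeight r) ε q F G + powHess (kornWeight r) ε q F H := by
  have hκ := kornWeight_nonneg (mul_pos ha hr).le
  have hκ' := kornWeight_nonneg hr.le
  have h1 := (powHess_bounds hκ hε (by linarith : 0 < q) F G).2
  have h2 := (powHess_bounds hκ hε (by linarith : 0 < q) F H).2
  have h3 := (powHess_bounds hκ' hε (by linarith : 0 < q) F G).1
  have h4 := (powHess_bounds hκ' hε (by linarith : 0 < q) F H).1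
  have hS := regSq_pos hκ' hε F
  have hSS : regSq (kornWeight (a * r)) ε F ^ (q - 1) ≤
      Λ * regSq (kornWeight r) ε F ^ (q - 1) := by
    refine hΛ _ _ hS ?_ ?_ <;> rw [regSq_kornWeight, regSq_kornWeight]
    · nlinarith [sq_nonneg (F 0)]
    · have : a * r ≤ r := mul_le_of_le_one_left hr.le ha1
      nlinarith [sq_nonneg (F 1), sq_nonneg (F 2), sq_nonneg (F 3)]
  set m := min 1 (2 * q - 1)
  set M := max 1 (2 * q - 1)
  have hm0 : 0 < m := lt_min one_pos (by linarith)
  have hM0 : 0 < M := lt_of_lt_of_le one_pos (le_max_left _ _)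
  set Y := regSq (kornWeight r) ε F ^ (q - 1)
  set Y' := regSq (kornWeight (a * r)) ε F ^ (q - 1)
  have hY : 0 < Y := by positivity
  have e : ∀ (s : ℝ) (G : Fin 4 → ℝ), ∑ i, kornWeight s i * G i ^ 2 =
      G 0 ^ 2 + s * (G 1 ^ 2 + G 2 ^ 2 + G 3 ^ 2) := by
    intro s G; simp [kornWeight, Fin.sum_univ_four]; ring
  rw [e] at h1 h2 h3 h4
  set E := (G 1 ^ 2 + G 2 ^ 2 + G 3 ^ 2) + (H 1 ^ 2 + H 2 ^ 2 + H 3 ^ 2) with hE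
  set W := G 0 ^ 2 + H 0 ^ 2 with hW
  have hE0 : 0 ≤ E := by positivity
  have hW0 : 0 ≤ W := by positivity
  have key : 2 * (M * (Y' * (W + a * r * E))) ≤ m * (Y * (W + r * E)) := by
    have k1 : Y' * (W + a * r * E) ≤ (Λ * Y) * ((8 + a * r) * E) := by
      refine mul_le_mul hSS (by nlinarith)
        (add_nonneg hW0 (mul_nonneg (mul_pos ha hr).le hE0)) ?_
      exact (Real.rpow_nonneg (regSq_pos hκ hε F).le _).trans hSS
    have k2 : m * (Y * (r * E)) ≤ m * (Y * (W + r * E)) := by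
      refine mul_le_mul_of_nonneg_left (mul_le_mul_of_nonneg_left (by linarith) hY.le) hm0.le
    have k3 : (2 * M * Λ * (8 + a * r)) * (Y * E) ≤ (m * r) * (Y * E) :=
      mul_le_mul_of_nonneg_right hm (by positivity)
    have k4 := mul_le_mul_of_nonneg_left k1 (by positivity : 0 ≤ 2 * M)
    nlinarith
  have key2 := mul_le_mul_of_nonneg_left key (by linarith : 0 ≤ 2 * q)
  rw [hW, hE] at key2
  linarith

lemma add_rpow_le_of_eta {q : ℝ} (hq : 0 < q) :
    ∃ K : ℝ, 0 < K ∧ ∀ A B : ℝ, 0 ≤ A → 0 ≤ B → (A + B) ^ q ≤ 3 / 2 * A ^ q + K * B ^ q := by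
  have ht : Tendsto (fun η : ℝ => (1 + η) ^ q) (𝓝[>] 0) (𝓝 1) := by
    have : ContinuousAt (fun η : ℝ => (1 + η) ^ q) 0 :=
      ContinuousAt.rpow_const (by fun_prop) (Or.inr hq.le)
    simpa using this.tendsto.mono_left nhdsWithin_le_nhds
  obtain ⟨η, hη, hη0⟩ := ((ht.eventually (ge_mem_nhds (by norm_num : (1 : ℝ) < 3 / 2))).and
    self_mem_nhdsWithin).exists
  have hη0 : 0 < η := hη0
  refine ⟨(η⁻¹ + 1) ^ q, by positivity, fun A B hA hB => ?_⟩
  rcases le_total B (η * A) with h | h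
  · have : (A + B) ^ q ≤ ((1 + η) * A) ^ q := Real.rpow_le_rpow (by positivity) (by linarith) hq.le
    rw [Real.mul_rpow (by positivity) hA] at this
    have h2 := mul_le_mul_of_nonneg_right hη (by positivity : 0 ≤ A ^ q)
    have h3 : 0 ≤ (η⁻¹ + 1) ^ q * B ^ q := by positivity
    linarith
  · have hA' : A ≤ η⁻¹ * B := by
      rw [inv_mul_eq_div, le_div_iff₀ hη0]; linarith
    have : (A + B) ^ q ≤ ((η⁻¹ + 1) * B) ^ q :=
      Real.rpow_le_rpow (by positivity) (by linarith) hq.le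
    rw [Real.mul_rpow (by positivity) hB] at this
    have h3 : 0 ≤ 3 / 2 * A ^ q := by positivity
    linarith

lemma add_four_rpow_le {q : ℝ} (hq : 0 < q) {a b c d : ℝ} (ha : 0 ≤ a) (hb : 0 ≤ b)
    (hc : 0 ≤ c) (hd : 0 ≤ d) :
    (a + b + c + d) ^ q ≤ 4 ^ q * (a ^ q + b ^ q + c ^ q + d ^ q) := by
  have key : ∀ m, 0 ≤ m → a ≤ m → b ≤ m → c ≤ m → d ≤ m → (a + b + c + d) ^ q ≤ 4 ^ q * m ^ q := by
    intro m hm h1 h2 h3 h4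
    rw [← Real.mul_rpow (by norm_num) hm]
    exact Real.rpow_le_rpow (by positivity) (by linarith) hq.le
  have pa : 0 ≤ a ^ q := by positivity
  have pb : 0 ≤ b ^ q := by positivity
  have pc : 0 ≤ c ^ q := by positivity
  have pd : 0 ≤ d ^ q := by positivity
  have p4 : (0 : ℝ) < 4 ^ q := by positivity
  have : ∃ m, 0 ≤ m ∧ a ≤ m ∧ b ≤ m ∧ c ≤ m ∧ d ≤ m ∧ m ^ q ≤ a ^ q + b ^ q + c ^ q + d ^ q := by
    rcases le_total a b with h1 | h1 <;> rcases le_total c d with h2 | h2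
    · rcases le_total b d with h3 | h3
      · exact ⟨d, hd, by linarith, h3, h2, le_rfl, by linarith⟩
      · exact ⟨b, hb, h1, le_rfl, by linarith, h3, by linarith⟩
    · rcases le_total b c with h3 | h3
      · exact ⟨c, hc, by linarith, h3, le_rfl, h2, by linarith⟩
      · exact ⟨b, hb, h1, le_rfl, h3, by linarith, by linarith⟩
    · rcases le_total a d with h3 | h3
      · exact ⟨d, hd, h3, by linarith, h2, le_rfl, by linarith⟩
      · exact ⟨a, ha, le_rfl, h1, by linarith, h3, by linarith⟩
    · rcases le_total a c with h3 | h3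
      · exact ⟨c, hc, h3, by linarith, le_rfl, h2, by linarith⟩
      · exact ⟨a, ha, le_rfl, h1, h3, by linarith, by linarith⟩
  obtain ⟨m, h0, h1, h2, h3, h4, h5⟩ := this
  exact (key m h0 h1 h2 h3 h4).trans (mul_le_mul_of_nonneg_left h5 p4.le)

lemma sq_rpow_half (x p : ℝ) : (x ^ 2) ^ (p / 2) = |x| ^ p := by
  rw [← sq_abs, ← Real.rpow_natCast, ← Real.rpow_mul (abs_nonneg x)]
  congr 1; push_cast; ring

lemma exists_korn_lower_bound {p r : ℝ} (hp : 0 < p) (hr : 0 < r) :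
    ∃ K : ℝ, 0 < K ∧ ∀ (s ε : ℝ) (F : Fin 4 → ℝ), 0 ≤ s → 0 < ε →
      1 / 2 * |F 0| ^ p ≤ (2 * regSq (kornWeight s) ε F ^ (p / 2) -
        regSq (kornWeight r) ε F ^ (p / 2)) +
        K * (|F 1| ^ p + |F 2| ^ p + |F 3| ^ p) + K * ε ^ (p / 2) := by
  obtain ⟨K, hK, hK'⟩ := add_rpow_le_of_eta (half_pos hp)
  refine ⟨K * (4 ^ (p / 2) * (r ^ (p / 2) + 1)), by positivity, fun s ε F hs hε => ?_⟩
  have h1 : |F 0| ^ p ≤ regSq (kornWeight s) ε F ^ (p / 2) := by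
    rw [← sq_rpow_half]
    refine Real.rpow_le_rpow (sq_nonneg _) ?_ (half_pos hp).le
    rw [regSq_kornWeight]
    have : 0 ≤ s * (F 1 ^ 2 + F 2 ^ 2 + F 3 ^ 2) := by positivity
    linarith
  have h2 := hK' (F 0 ^ 2) (r * F 1 ^ 2 + r * F 2 ^ 2 + r * F 3 ^ 2 + ε) (sq_nonneg _)
    (by positivity)
  have e2 : regSq (kornWeight r) ε F =
      F 0 ^ 2 + (r * F 1 ^ 2 + r * F 2 ^ 2 + r * F 3 ^ 2 + ε) := by
    rw [regSq_kornWeight]; ring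
  have h3 := add_four_rpow_le (half_pos hp) (by positivity : 0 ≤ r * F 1 ^ 2)
    (by positivity : 0 ≤ r * F 2 ^ 2) (by positivity : 0 ≤ r * F 3 ^ 2) hε.le
  simp only [Real.mul_rpow hr.le (sq_nonneg _), sq_rpow_half] at h2 h3
  rw [← e2] at h2
  have h4 := mul_le_mul_of_nonneg_left h3 hK.le
  have p1 : 0 ≤ |F 1| ^ p := by positivity
  have p2 : 0 ≤ |F 2| ^ p := by positivity
  have p3 : 0 ≤ |F 3| ^ p := by positivity
  have p4 : 0 ≤ ε ^ (p / 2) := by positivity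
  have pr : 0 ≤ r ^ (p / 2) := by positivity
  have h5 : K * (4 ^ (p / 2) * (r ^ (p / 2) * |F 1| ^ p + r ^ (p / 2) * |F 2| ^ p +
      r ^ (p / 2) * |F 3| ^ p + ε ^ (p / 2))) ≤
      K * (4 ^ (p / 2) * ((r ^ (p / 2) + 1) *
        (|F 1| ^ p + |F 2| ^ p + |F 3| ^ p + ε ^ (p / 2)))) := by
    refine mul_le_mul_of_nonneg_left (mul_le_mul_of_nonneg_left ?_ (by positivity)) hK.le
    nlinarith [mul_nonneg pr p4]
  linarith

section

variable {ι : Type*} {J : Finset ι} {α β : ι → ℝ}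

/-- The Fourier coefficients of the curl and of the three strain components of the field with
coefficients `c`, `d`. -/
noncomputable def strainCoeff (α β : ι → ℝ) (c d : ι → ℂ) : Fin 4 → ι → ℂ :=
  ![fun j => Complex.I * α j * d j - Complex.I * β j * c j,
    fun j => Complex.I * α j * c j,
    fun j => Complex.I * β j * d j,
    fun j => Complex.I * β j * c j + Complex.I * α j * d j]

/-- The curl and strain components of a field evolving by the heat equation. -/
noncomputable def strainField (J : Finset ι) (α β : ι → ℝ) (c d : ι → ℂ) (t x y : ℝ) :
    Fin 4 → ℝ := fun i => heatSum J α β (strainCoeff α β c d i) t x y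

/-- The `∂₁`-derivative of `strainField`. -/
noncomputable def strainField₁ (J : Finset ι) (α β : ι → ℝ) (c d : ι → ℂ) (t x y : ℝ) :
    Fin 4 → ℝ := fun i => heatSum J α β (fun j => Complex.I * α j * strainCoeff α β c d i j) t x y

/-- The `∂₂`-derivative of `strainField`. -/
noncomputable def strainField₂ (J : Finset ι) (α β : ι → ℝ) (c d : ι → ℂ) (t x y : ℝ) :
    Fin 4 → ℝ := fun i => heatSum J α β (fun j => Complex.I * β j * strainCoeff α β c d i j) t x y

lemma curl_grad_sq_le (c d : ι → ℂ) (t x y : ℝ) :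
    strainField₁ J α β c d t x y 0 ^ 2 + strainField₂ J α β c d t x y 0 ^ 2 ≤
      8 * ((strainField₁ J α β c d t x y 1 ^ 2 + strainField₁ J α β c d t x y 2 ^ 2 +
        strainField₁ J α β c d t x y 3 ^ 2) +
        (strainField₂ J α β c d t x y 1 ^ 2 + strainField₂ J α β c d t x y 2 ^ 2 +
        strainField₂ J α β c d t x y 3 ^ 2)) := by
  have h1 : strainField₁ J α β c d t x y 0 =
      strainField₁ J α β c d t x y 3 - 2 * strainField₂ J α β c d t x y 1 := by
    unfold strainField₁ strainField₂
    rw [← heatSum_const_mul, ← heatSum_sub]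
    congr 1
    ext j
    simp only [strainCoeff, Matrix.cons_val]
    push_cast; ring
  have h2 : strainField₂ J α β c d t x y 0 =
      2 * strainField₁ J α β c d t x y 2 - strainField₂ J α β c d t x y 3 := by
    unfold strainField₁ strainField₂
    rw [← heatSum_const_mul, ← heatSum_sub]
    congr 1
    ext j
    simp only [strainCoeff, Matrix.cons_val]
    push_cast; ring
  rw [h1, h2]
  generalize strainField₁ J α β c d t x y = G
  generalize strainField₂ J α β c d t x y = H
  nlinarith [sq_nonneg (G 3 + 2 * H 1), sq_nonneg (2 * G 2 + H 3), sq_nonneg (G 1),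
    sq_nonneg (G 3), sq_nonneg (H 2), sq_nonneg (H 3)]

lemma Continuous.regSq {X : Type*} [TopologicalSpace X] {κ : Fin 4 → ℝ} {ε : ℝ}
    {F : X → Fin 4 → ℝ} (hF : ∀ i, Continuous fun x => F x i) :
    Continuous fun x => _root_.regSq κ ε (F x) := by
  unfold _root_.regSq
  exact continuous_const.add (continuous_finsetSum _ fun i _ => ((hF i).pow 2).const_mul _)

lemma Continuous.regSq_rpow {X : Type*} [TopologicalSpace X] {κ : Fin 4 → ℝ} {ε : ℝ}
    (hκ : ∀ i, 0 ≤ κ i) (hε : 0 < ε) (q : ℝ)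
    {F : X → Fin 4 → ℝ} (hF : ∀ i, Continuous fun x => F x i) :
    Continuous fun x => _root_.regSq κ ε (F x) ^ q :=
  (Continuous.regSq hF).rpow_const fun _ => Or.inl (regSq_pos hκ hε _).ne'

lemma Continuous.powGrad {X : Type*} [TopologicalSpace X] {κ : Fin 4 → ℝ} {ε : ℝ}
    (hκ : ∀ i, 0 ≤ κ i) (hε : 0 < ε) (q : ℝ)
    {F G : X → Fin 4 → ℝ} (hF : ∀ i, Continuous fun x => F x i)
    (hG : ∀ i, Continuous fun x => G x i) :
    Continuous fun x => _root_.powGrad κ ε q (F x) (G x) := by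
  unfold _root_.powGrad
  exact (continuous_const.mul (Continuous.regSq_rpow hκ hε _ hF)).mul
    (continuous_finsetSum _ fun i _ => ((hF i).mul (hG i)).const_mul _)

lemma Continuous.powHess {X : Type*} [TopologicalSpace X] {κ : Fin 4 → ℝ} {ε : ℝ}
    (hκ : ∀ i, 0 ≤ κ i) (hε : 0 < ε) (q : ℝ)
    {F G : X → Fin 4 → ℝ} (hF : ∀ i, Continuous fun x => F x i)
    (hG : ∀ i, Continuous fun x => G x i) :
    Continuous fun x => _root_.powHess κ ε q (F x) (G x) := by
  unfold _root_.powHess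
  exact ((continuous_const.mul (Continuous.regSq_rpow hκ hε _ hF)).mul
    (continuous_finsetSum _ fun i _ => ((hG i).pow 2).const_mul _)).add
    ((continuous_const.mul (Continuous.regSq_rpow hκ hε _ hF)).mul
    ((continuous_finsetSum _ fun i _ => ((hF i).mul (hG i)).const_mul _).pow 2))

lemma powGrad_add {κ : Fin 4 → ℝ} {ε q : ℝ} (F G H : Fin 4 → ℝ) :
    powGrad κ ε q F (fun i => G i + H i) = powGrad κ ε q F G + powGrad κ ε q F H := by
  unfold powGrad
  simp only [mul_add, Finset.sum_add_distrib]

/-- Along the heat flow, the integral of a function of curl and strain which is concave in the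
relevant directions is nondecreasing. -/
lemma setIntegral_kornFunction_le {b e T q a r ε : ℝ} (hbe : b ≤ e) (hT : 0 ≤ T)
    (hα : ∀ j, Complex.exp (Complex.I * α j) = 1)
    (hβ : ∀ j, Complex.exp (Complex.I * (β j * (e - b))) = 1) (c d : ι → ℂ)
    (ha : 0 < a) (hr : 0 < r) (hε : 0 < ε)
    (hess : ∀ F G H : Fin 4 → ℝ, G 0 ^ 2 + H 0 ^ 2 ≤ 8 * ((G 1 ^ 2 + G 2 ^ 2 + G 3 ^ 2) +
        (H 1 ^ 2 + H 2 ^ 2 + H 3 ^ 2)) →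
      2 * (powHess (kornWeight (a * r)) ε q F G + powHess (kornWeight (a * r)) ε q F H) ≤
        powHess (kornWeight r) ε q F G + powHess (kornWeight r) ε q F H) :
    ∫ z in Icc (0 : ℝ) 1 ×ˢ Icc b e,
        (2 * regSq (kornWeight (a * r)) ε (strainField J α β c d 0 z.1 z.2) ^ q -
          regSq (kornWeight r) ε (strainField J α β c d 0 z.1 z.2) ^ q) ≤
      ∫ z in Icc (0 : ℝ) 1 ×ˢ Icc b e,
        (2 * regSq (kornWeight (a * r)) ε (strainField J α β c d T z.1 z.2) ^ q -
          regSq (kornWeight r) ε (strainField J α β c d T z.1 z.2) ^ q) := by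
  have hκ := kornWeight_nonneg (mul_pos ha hr).le
  have hκ' := kornWeight_nonneg hr.le
  set C := strainCoeff α β c d with hC
  set F := strainField J α β c d
  set G := strainField₁ J α β c d
  set H := strainField₂ J α β c d
  let GG : ℝ → ℝ → ℝ → Fin 4 → ℝ := fun t x y i =>
    heatSum J α β (fun j => Complex.I * α j * (Complex.I * α j * C i j)) t x y
  let HH : ℝ → ℝ → ℝ → Fin 4 → ℝ := fun t x y i =>
    heatSum J α β (fun j => Complex.I * β j * (Complex.I * β j * C i j)) t x y
  have dFt : ∀ t x y i, HasDerivAt (fun s => F s x y i) (GG t x y i + HH t x y i) t := by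
    intro t x y i
    refine (hasDerivAt_heatSum_time (C i) t x y).congr_deriv ?_
    simp only [GG, HH]
    rw [← heatSum_add]
    congr 1
    ext j
    linear_combination (-(α j : ℂ) ^ 2 * C i j - (β j : ℂ) ^ 2 * C i j) * Complex.I_sq
  have dFx : ∀ t x y i, HasDerivAt (fun s => F t s y i) (G t x y i) x :=
    fun t x y i => hasDerivAt_heatSum_fst _ t x y
  have dFy : ∀ t x y i, HasDerivAt (fun s => F t x s i) (H t x y i) y :=
    fun t x y i => hasDerivAt_heatSum_snd _ t x y
  have dGx : ∀ t x y i, HasDerivAt (fun s => G t s y i) (GG t x y i) x :=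
    fun t x y i => hasDerivAt_heatSum_fst _ t x y
  have dHy : ∀ t x y i, HasDerivAt (fun s => H t x s i) (HH t x y i) y :=
    fun t x y i => hasDerivAt_heatSum_snd _ t x y
  have cF : ∀ i, Continuous fun z : ℝ × ℝ × ℝ => F z.1 z.2.1 z.2.2 i :=
    fun i => continuous_heatSum _
  have cG : ∀ i, Continuous fun z : ℝ × ℝ × ℝ => G z.1 z.2.1 z.2.2 i :=
    fun i => continuous_heatSum _
  have cH : ∀ i, Continuous fun z : ℝ × ℝ × ℝ => H z.1 z.2.1 z.2.2 i :=
    fun i => continuous_heatSum _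
  have cGG : ∀ i, Continuous fun z : ℝ × ℝ × ℝ => GG z.1 z.2.1 z.2.2 i :=
    fun i => continuous_heatSum _
  have cHH : ∀ i, Continuous fun z : ℝ × ℝ × ℝ => HH z.1 z.2.1 z.2.2 i :=
    fun i => continuous_heatSum _
  have pF1 : ∀ t y, F t 1 y = F t 0 y := fun t y => by
    ext i; exact heatSum_periodic_fst hα _ t y
  have pG1 : ∀ t y, G t 1 y = G t 0 y := fun t y => by
    ext i; exact heatSum_periodic_fst hα _ t y
  have pF2 : ∀ t x, F t x e = F t x b := fun t y => by
    ext i; exact heatSum_periodic_snd hβ _ t y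
  have pH2 : ∀ t x, H t x e = H t x b := fun t y => by
    ext i; exact heatSum_periodic_snd hβ _ t y
  refine setIntegral_le_of_supercaloric hbe hT
    (V := fun t x y => 2 * regSq (kornWeight (a * r)) ε (F t x y) ^ q -
      regSq (kornWeight r) ε (F t x y) ^ q)
    (Vt := fun t x y =>
      2 * powGrad (kornWeight (a * r)) ε q (F t x y) (fun i => GG t x y i + HH t x y i) -
      powGrad (kornWeight r) ε q (F t x y) (fun i => GG t x y i + HH t x y i))
    (Vx := fun t x y => 2 * powGrad (kornWeight (a * r)) ε q (F t x y) (G t x y) -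
      powGrad (kornWeight r) ε q (F t x y) (G t x y))
    (Vy := fun t x y => 2 * powGrad (kornWeight (a * r)) ε q (F t x y) (H t x y) -
      powGrad (kornWeight r) ε q (F t x y) (H t x y))
    (Vxx := fun t x y => 2 * (powHess (kornWeight (a * r)) ε q (F t x y) (G t x y) +
        powGrad (kornWeight (a * r)) ε q (F t x y) (GG t x y)) -
      (powHess (kornWeight r) ε q (F t x y) (G t x y) +
        powGrad (kornWeight r) ε q (F t x y) (GG t x y)))
    (Vyy := fun t x y => 2 * (powHess (kornWeight (a * r)) ε q (F t x y) (H t x y) +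
        powGrad (kornWeight (a * r)) ε q (F t x y) (HH t x y)) -
      (powHess (kornWeight r) ε q (F t x y) (H t x y) +
        powGrad (kornWeight r) ε q (F t x y) (HH t x y)))
    ?_ ?_ ?_ ?_ ?_ ?_ ?_ ?_ ?_ ?_
  · exact ((Continuous.regSq_rpow hκ hε _ cF).const_mul 2).sub (Continuous.regSq_rpow hκ' hε _ cF)
  · exact ((Continuous.powGrad hκ hε _ cF fun i => (cGG i).add (cHH i)).const_mul 2).sub
      (Continuous.powGrad hκ' hε _ cF fun i => (cGG i).add (cHH i))
  · exact (((Continuous.powHess hκ hε _ cF cG).add (Continuous.powGrad hκ hε _ cF cGG)).const_mul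
      2).sub ((Continuous.powHess hκ' hε _ cF cG).add (Continuous.powGrad hκ' hε _ cF cGG))
  · exact (((Continuous.powHess hκ hε _ cF cH).add (Continuous.powGrad hκ hε _ cF cHH)).const_mul
      2).sub ((Continuous.powHess hκ' hε _ cF cH).add (Continuous.powGrad hκ' hε _ cF cHH))
  · exact fun t x y => ((hasDerivAt_regSq_rpow (F := fun s => F s x y)
      (G := fun s i => GG s x y i + HH s x y i) hκ hε (dFt t x y)).const_mul 2).sub
      (hasDerivAt_regSq_rpow (F := fun s => F s x y)
      (G := fun s i => GG s x y i + HH s x y i) hκ' hε (dFt t x y))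
  · exact fun t x y => ((hasDerivAt_powGrad (F := fun s => F t s y) (G := fun s => G t s y)
      (H := fun s => GG t s y) hκ hε (dFx t x y) (dGx t x y)).const_mul 2).sub
      (hasDerivAt_powGrad (F := fun s => F t s y) (G := fun s => G t s y)
      (H := fun s => GG t s y) hκ' hε (dFx t x y) (dGx t x y))
  · exact fun t x y => ((hasDerivAt_powGrad (F := fun s => F t x s) (G := fun s => H t x s)
      (H := fun s => HH t x s) hκ hε (dFy t x y) (dHy t x y)).const_mul 2).sub
      (hasDerivAt_powGrad (F := fun s => F t x s) (G := fun s => H t x s)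
      (H := fun s => HH t x s) hκ' hε (dFy t x y) (dHy t x y))
  · intro t y; simp only [pF1, pG1]
  · intro t y; simp only [pF2, pH2]
  · intro t x y
    have := hess (F t x y) (G t x y) (H t x y) (curl_grad_sq_le c d t x y)
    simp only [powGrad_add]
    linarith

end

section

lemma volume_box_ne_top (b e : ℝ) : volume (Icc (0 : ℝ) 1 ×ˢ Icc b e) ≠ ⊤ :=
  (isCompact_Icc.prod isCompact_Icc).measure_lt_top.ne

lemma setIntegral_box_const {b e : ℝ} (hbe : b ≤ e) (k : ℝ) :
    ∫ _ in Icc (0 : ℝ) 1 ×ˢ Icc b e, k = k * (e - b) := by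
  rw [setIntegral_const, measureReal_def, Measure.volume_eq_prod, Measure.prod_prod]
  simp [hbe, mul_comm]

lemma tendsto_setIntegral_kornFunction {b e q s s' ε M : ℝ} {F : ℝ → ℝ × ℝ → Fin 4 → ℝ}
    (hs : 0 ≤ s) (hs' : 0 ≤ s') (hε : 0 < ε) (hq : 0 < q)
    (cF : ∀ t i, Continuous fun z => F t z i)
    (hM : ∀ t, 0 ≤ t → ∀ z i, |F t z i| ≤ M)
    (h0 : ∀ z i, Tendsto (fun t => F t z i) atTop (𝓝 0)) :
    Tendsto (fun T : ℝ => ∫ z in Icc (0 : ℝ) 1 ×ˢ Icc b e,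
      (2 * regSq (kornWeight s) ε (F T z) ^ q - regSq (kornWeight s') ε (F T z) ^ q)) atTop
      (𝓝 (∫ _ in Icc (0 : ℝ) 1 ×ˢ Icc b e, ε ^ q)) := by
  have hlim : ∀ s, 0 ≤ s → ∀ z : ℝ × ℝ,
      Tendsto (fun t => regSq (kornWeight s) ε (F t z) ^ q) atTop (𝓝 (ε ^ q)) := by
    intro s hs z
    have h1 : Tendsto (fun t => regSq (kornWeight s) ε (F t z)) atTop (𝓝 ε) := by
      unfold regSq
      have := (tendsto_finsetSum Finset.univ
        fun i _ => ((h0 z i).pow 2).const_mul (kornWeight s i)).const_add ε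
      simpa using this
    exact h1.rpow_const (Or.inl hε.ne')
  have hbd : ∀ s, 0 ≤ s → ∀ t, 0 ≤ t → ∀ z : ℝ × ℝ,
      |regSq (kornWeight s) ε (F t z) ^ q| ≤ (ε + ∑ i, kornWeight s i * M ^ 2) ^ q := by
    intro s hs t ht z
    have hp := regSq_pos (kornWeight_nonneg hs) hε (F t z)
    rw [abs_of_nonneg (Real.rpow_nonneg hp.le _)]
    refine Real.rpow_le_rpow hp.le ?_ hq.le
    unfold regSq
    refine add_le_add le_rfl (Finset.sum_le_sum fun i _ =>
      mul_le_mul_of_nonneg_left ?_ (kornWeight_nonneg hs i))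
    exact sq_le_sq' (neg_le_of_abs_le (hM t ht z i)) (le_of_abs_le (hM t ht z i))
  refine tendsto_integral_filter_of_dominated_convergence
    (fun _ => 2 * (ε + ∑ i, kornWeight s i * M ^ 2) ^ q +
      (ε + ∑ i, kornWeight s' i * M ^ 2) ^ q) ?_ ?_ ?_ ?_
  · exact Eventually.of_forall fun t =>
      (((Continuous.regSq_rpow (kornWeight_nonneg hs) hε _ (cF t)).const_mul 2).sub
      (Continuous.regSq_rpow (kornWeight_nonneg hs') hε _ (cF t))).aestronglyMeasurable
  · filter_upwards [eventually_ge_atTop 0] with t ht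
    refine Eventually.of_forall fun z => ?_
    have h1 := hbd _ hs t ht z
    have h2 := hbd _ hs' t ht z
    rw [Real.norm_eq_abs]
    refine (abs_sub _ _).trans (add_le_add ?_ h2)
    rw [abs_mul, abs_two]
    linarith
  · exact integrableOn_const (volume_box_ne_top b e)
  · refine Eventually.of_forall fun z => ?_
    have := ((hlim _ hs z).const_mul 2).sub (hlim _ hs' z)
    rwa [two_mul, add_sub_cancel_right] at this

lemma setIntegral_rpow_le_of_kornFunction_le {b e p r s K : ℝ} {F : ℝ × ℝ → Fin 4 → ℝ}
    (hp0 : 0 < p) (hbe : b ≤ e) (hs : 0 ≤ s) (hr : 0 ≤ r) (cF : ∀ i, Continuous fun z => F z i)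
    (hlow : ∀ (ε : ℝ) (F : Fin 4 → ℝ), 0 < ε →
      1 / 2 * |F 0| ^ p ≤ (2 * regSq (kornWeight s) ε F ^ (p / 2) -
        regSq (kornWeight r) ε F ^ (p / 2)) +
        K * (|F 1| ^ p + |F 2| ^ p + |F 3| ^ p) + K * ε ^ (p / 2))
    (hU : ∀ ε : ℝ, 0 < ε → ∫ z in Icc (0 : ℝ) 1 ×ˢ Icc b e,
      (2 * regSq (kornWeight s) ε (F z) ^ (p / 2) - regSq (kornWeight r) ε (F z) ^ (p / 2)) ≤
        ε ^ (p / 2) * (e - b)) :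
    ∫ z in Icc (0 : ℝ) 1 ×ˢ Icc b e, |F z 0| ^ p ≤
      2 * K * ∫ z in Icc (0 : ℝ) 1 ×ˢ Icc b e, (|F z 1| ^ p + |F z 2| ^ p + |F z 3| ^ p) := by
  have cP : ∀ i, Continuous fun z : ℝ × ℝ => |F z i| ^ p := fun i =>
    (cF i).abs.rpow_const fun _ => Or.inr hp0.le
  have key : ∀ ε : ℝ, 0 < ε → ∫ z in Icc (0 : ℝ) 1 ×ˢ Icc b e, |F z 0| ^ p ≤
      2 * K * (∫ z in Icc (0 : ℝ) 1 ×ˢ Icc b e, (|F z 1| ^ p + |F z 2| ^ p + |F z 3| ^ p)) +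
        2 * (K + 1) * (e - b) * ε ^ (p / 2) := by
    intro ε hε
    have h1 := hU ε hε
    have cU : Continuous fun z => 2 * regSq (kornWeight s) ε (F z) ^ (p / 2) -
        regSq (kornWeight r) ε (F z) ^ (p / 2) :=
      ((Continuous.regSq_rpow (kornWeight_nonneg hs) hε (p / 2) cF).const_mul 2).sub
      (Continuous.regSq_rpow (kornWeight_nonneg hr) hε (p / 2) cF)
    have cE : Continuous fun z => K * (|F z 1| ^ p + |F z 2| ^ p + |F z 3| ^ p) :=
      (((cP 1).add (cP 2)).add (cP 3)).const_mul K
    have cUE : Continuous fun z => (2 * regSq (kornWeight s) ε (F z) ^ (p / 2) -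
        regSq (kornWeight r) ε (F z) ^ (p / 2)) +
        K * (|F z 1| ^ p + |F z 2| ^ p + |F z 3| ^ p) := cU.add cE
    have h2 : ∫ z in Icc (0 : ℝ) 1 ×ˢ Icc b e, 1 / 2 * |F z 0| ^ p ≤
        ∫ z in Icc (0 : ℝ) 1 ×ˢ Icc b e, ((2 * regSq (kornWeight s) ε (F z) ^ (p / 2) -
        regSq (kornWeight r) ε (F z) ^ (p / 2)) +
        K * (|F z 1| ^ p + |F z 2| ^ p + |F z 3| ^ p) + K * ε ^ (p / 2)) :=
      integral_mono ((cP 0).const_mul (1 / 2)).integrableOn_box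
        (cUE.add continuous_const).integrableOn_box (fun z => hlow ε (F z) hε)
    rw [integral_add cUE.integrableOn_box continuous_const.integrableOn_box,
      integral_add cU.integrableOn_box cE.integrableOn_box, integral_const_mul,
      integral_const_mul, setIntegral_box_const hbe] at h2
    linarith
  have hlim : ∀ X Y : ℝ, Tendsto (fun ε : ℝ => X + Y * ε ^ (p / 2)) (𝓝[>] 0) (𝓝 X) := by
    intro X Y
    have : ContinuousAt (fun ε : ℝ => X + Y * ε ^ (p / 2)) 0 :=
      continuousAt_const.add (continuousAt_const.mul
        (Real.continuousAt_rpow_const 0 _ (Or.inr (by linarith))))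
    have h := this.tendsto
    rw [Real.zero_rpow (by linarith), mul_zero, add_zero] at h
    exact h.mono_left nhdsWithin_le_nhds
  refine ge_of_tendsto (hlim _ (2 * (K + 1) * (e - b))) ?_
  filter_upwards [self_mem_nhdsWithin] with ε hε
  exact key ε hε

variable {ι : Type*} {J : Finset ι} {α β : ι → ℝ}

lemma abs_strainField_le (c d : ι → ℂ) {t : ℝ} (ht : 0 ≤ t) (x y : ℝ) (i : Fin 4) :
    |strainField J α β c d t x y i| ≤ ∑ i, ∑ j ∈ J, ‖strainCoeff α β c d i j‖ :=
  (abs_heatSum_le _ ht _ _).trans (Finset.single_le_sum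
    (f := fun i => ∑ j ∈ J, ‖strainCoeff α β c d i j‖)
    (fun _ _ => Finset.sum_nonneg fun _ _ => norm_nonneg _) (Finset.mem_univ i))

lemma tendsto_strainField (c d : ι → ℂ) (x y : ℝ) (i : Fin 4) :
    Tendsto (fun t => strainField J α β c d t x y i) atTop (𝓝 0) := by
  unfold strainField
  refine tendsto_heatSum_atTop _ (fun j _ h1 h2 => ?_) x y
  fin_cases i <;> simp [strainCoeff, h1, h2]

lemma continuous_strainField (c d : ι → ℂ) (t : ℝ) (i : Fin 4) :
    Continuous fun z : ℝ × ℝ => strainField J α β c d t z.1 z.2 i := by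
  have h : Continuous fun z : ℝ × ℝ => (t, z.1, z.2) := by fun_prop
  have h2 := (continuous_heatSum (J := J) (α := α) (β := β) (strainCoeff α β c d i)).comp h
  exact h2

lemma setIntegral_strainField_le {p a r K b e : ℝ} (hp : 1 < p) (ha : 0 < a) (hr : 0 < r)
    (hbe : b ≤ e) (hα : ∀ j, Complex.exp (Complex.I * α j) = 1)
    (hβ : ∀ j, Complex.exp (Complex.I * (β j * (e - b))) = 1) (c d : ι → ℂ)
    (hess : ∀ ε, 0 < ε → ∀ F G H : Fin 4 → ℝ,
      G 0 ^ 2 + H 0 ^ 2 ≤ 8 * ((G 1 ^ 2 + G 2 ^ 2 + G 3 ^ 2) +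
        (H 1 ^ 2 + H 2 ^ 2 + H 3 ^ 2)) →
      2 * (powHess (kornWeight (a * r)) ε (p / 2) F G +
        powHess (kornWeight (a * r)) ε (p / 2) F H) ≤
        powHess (kornWeight r) ε (p / 2) F G + powHess (kornWeight r) ε (p / 2) F H) 
    (hlow : ∀ (ε : ℝ) (F : Fin 4 → ℝ), 0 < ε →
      1 / 2 * |F 0| ^ p ≤ (2 * regSq (kornWeight (a * r)) ε F ^ (p / 2) -
        regSq (kornWeight r) ε F ^ (p / 2)) +
        K * (|F 1| ^ p + |F 2| ^ p + |F 3| ^ p) + K * ε ^ (p / 2)) :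
      ∫ z in Icc (0 : ℝ) 1 ×ˢ Icc b e, |strainField J α β c d 0 z.1 z.2 0| ^ p ≤
        2 * K * ∫ z in Icc (0 : ℝ) 1 ×ˢ Icc b e, (|strainField J α β c d 0 z.1 z.2 1| ^ p +
          |strainField J α β c d 0 z.1 z.2 2| ^ p + |strainField J α β c d 0 z.1 z.2 3| ^ p) := by
  have hp0 : 0 < p := by linarith
  have hU : ∀ ε : ℝ, 0 < ε → ∫ z in Icc (0 : ℝ) 1 ×ˢ Icc b e,
      (2 * regSq (kornWeight (a * r)) ε (strainField J α β c d 0 z.1 z.2) ^ (p / 2) -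
        regSq (kornWeight r) ε (strainField J α β c d 0 z.1 z.2) ^ (p / 2)) ≤
        ε ^ (p / 2) * (e - b) := by
    intro ε hε
    have h1 := tendsto_setIntegral_kornFunction (b := b) (e := e) (s := a * r) (s' := r)
      (F := fun t z => strainField J α β c d t z.1 z.2) (mul_pos ha hr).le hr.le hε
      (half_pos hp0) (continuous_strainField c d)
      (fun t ht z i => abs_strainField_le c d ht z.1 z.2 i)
      (fun z i => tendsto_strainField c d z.1 z.2 i)
    rw [setIntegral_box_const hbe] at h1
    refine ge_of_tendsto h1 ?_
    filter_upwards [eventually_ge_atTop 0] with T hT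
    exact setIntegral_kornFunction_le hbe hT hα hβ c d ha hr hε (hess ε hε)
  exact setIntegral_rpow_le_of_kornFunction_le (s := a * r) (r := r)
    (F := fun z => strainField J α β c d 0 z.1 z.2) hp0 hbe (mul_pos ha hr).le hr.le
    (continuous_strainField c d 0) hlow hU

/-- Korn's inequality for trigonometric polynomials on a flat torus. -/
lemma exists_korn_trigonometric {p : ℝ} (hp : 1 < p) :
    ∃ K : ℝ, 0 < K ∧ ∀ (ι : Type) (J : Finset ι) (α β : ι → ℝ) (c d : ι → ℂ) (b e : ℝ),
      b ≤ e → (∀ j, Complex.exp (Complex.I * α j) = 1) →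
      (∀ j, Complex.exp (Complex.I * (β j * (e - b))) = 1) →
      ∫ z in Icc (0 : ℝ) 1 ×ˢ Icc b e, |strainField J α β c d 0 z.1 z.2 0| ^ p ≤
        K * ∫ z in Icc (0 : ℝ) 1 ×ˢ Icc b e, (|strainField J α β c d 0 z.1 z.2 1| ^ p +
          |strainField J α β c d 0 z.1 z.2 2| ^ p + |strainField J α β c d 0 z.1 z.2 3| ^ p) := by
  have hp0 : 0 < p := by linarith
  obtain ⟨a, r, Λ, ha, ha1, hr, hΛ, hm⟩ := exists_korn_weights (q := p / 2) (by linarith)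
  obtain ⟨K, hK, hlow⟩ := exists_korn_lower_bound hp0 hr
  refine ⟨2 * K, by positivity, ?_⟩
  intro ι J α β c d b e hbe hα hβ
  exact setIntegral_strainField_le hp ha hr hbe hα hβ c d
    (fun ε hε F G H h => two_mul_powHess_le (by linarith) ha ha1 hr hε hΛ hm h)
    (fun ε F hε => hlow (a * r) ε F (mul_pos ha hr).le hε)

end

/-- The frequencies in the first variable of the powers of `cosKernel`. -/
noncomputable def cosFreqFst (n : ℕ) (j : ℕ × ℕ) : ℝ := 2 * Real.pi * (j.1 - n)

/-- The frequencies in the second variable of the powers of `cosKernel`. -/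
noncomputable def cosFreqSnd (L : ℝ) (n : ℕ) (j : ℕ × ℕ) : ℝ := 2 * Real.pi * (j.2 - n) / L

/-- The indices of the frequencies of the `n`-th power of `cosKernel`. -/
def cosIndex (n : ℕ) : Finset (ℕ × ℕ) := Finset.range (2 * n + 1) ×ˢ Finset.range (2 * n + 1)

/-- A trigonometric polynomial with periods `1` and `L` which peaks exactly at the lattice. -/
noncomputable def cosKernel (L : ℝ) (z : ℝ × ℝ) : ℝ :=
  Real.cos (Real.pi * z.1) ^ 2 * Real.cos (Real.pi * (z.2 / L)) ^ 2

lemma cos_pow_eq_sum (n : ℕ) (x : ℝ) :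
    (((Real.cos (Real.pi * x) ^ 2) ^ n : ℝ) : ℂ) = ∑ k ∈ Finset.range (2 * n + 1),
      (((2 * n).choose k : ℂ) / 4 ^ n) *
        Complex.exp (Complex.I * (2 * Real.pi * (k - n) * x : ℝ)) := by
  rw [← pow_mul]
  push_cast
  rw [Complex.cos, div_pow, add_pow, Finset.sum_div]
  refine Finset.sum_congr rfl fun k hk => ?_
  have hk : k ≤ 2 * n := Nat.lt_succ_iff.mp (Finset.mem_range.mp hk)
  rw [← Complex.exp_nat_mul, ← Complex.exp_nat_mul, ← Complex.exp_add, pow_mul]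
  have h4 : (2 : ℂ) ^ 2 = 4 := by norm_num
  rw [h4, mul_comm (Complex.exp _), mul_div_right_comm]
  congr 2
  push_cast [Nat.cast_sub hk]
  ring

lemma cosKernel_pow_eq_sum (L : ℝ) (n : ℕ) (z : ℝ × ℝ) :
    ((cosKernel L z ^ n : ℝ) : ℂ) = ∑ j ∈ cosIndex n,
      (((2 * n).choose j.1 : ℂ) / 4 ^ n * (((2 * n).choose j.2 : ℂ) / 4 ^ n)) *
        Complex.exp (Complex.I * (cosFreqFst n j * z.1 + cosFreqSnd L n j * z.2)) := by
  rw [cosKernel, mul_pow, Complex.ofReal_mul, cos_pow_eq_sum, cos_pow_eq_sum, Finset.sum_mul_sum,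
    cosIndex, Finset.sum_product]
  refine Finset.sum_congr rfl fun k _ => Finset.sum_congr rfl fun l _ => ?_
  rw [mul_mul_mul_comm, ← Complex.exp_add]
  congr 2
  unfold cosFreqFst cosFreqSnd
  push_cast
  ring

lemma continuous_cosKernel (L : ℝ) : Continuous (cosKernel L) := by
  unfold cosKernel
  fun_prop

lemma cosKernel_nonneg (L : ℝ) (z : ℝ × ℝ) : 0 ≤ cosKernel L z := by
  unfold cosKernel
  positivity

/-- The total mass of the `n`-th power of `cosKernel`. -/
noncomputable def cosMass (b e : ℝ) (n : ℕ) : ℝ :=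
  ∫ z in Icc (0 : ℝ) 1 ×ˢ Icc b e, cosKernel (e - b) z ^ n

lemma setIntegral_cosKernel {b e : ℝ} (hbe : b < e) (n : ℕ) (z : ℝ × ℝ) :
    ∫ s in Icc (0 : ℝ) 1 ×ˢ Icc b e, cosKernel (e - b) (z - s) ^ n = cosMass b e n := by
  have hL : e - b ≠ 0 := (sub_pos.2 hbe).ne'
  have per : ∀ f : ℝ → ℝ, Function.Periodic f Real.pi → ∀ (T : ℝ), T ≠ 0 →
      Function.Periodic (fun x => f (Real.pi * (x / T))) T := by
    intro f hf T hT x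
    show f _ = f _
    rw [add_div, div_self hT, mul_add, mul_one]
    exact hf _
  have hcos : Function.Periodic (fun x => (Real.cos x ^ 2) ^ n) Real.pi := fun x => by
    simp [Real.cos_add_pi]
  have shift : ∀ (T lo hi x : ℝ), hi - lo = T → T ≠ 0 →
      ∫ s in lo..hi, (Real.cos (Real.pi * ((x - s) / T)) ^ 2) ^ n =
        ∫ s in lo..hi, (Real.cos (Real.pi * (s / T)) ^ 2) ^ n := by
    intro T lo hi x hT hT0
    rw [intervalIntegral.integral_comp_sub_left
      (fun s => (Real.cos (Real.pi * (s / T)) ^ 2) ^ n) x]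
    have := (per _ hcos T hT0).intervalIntegral_add_eq (x - hi) lo
    rw [show x - hi + T = x - lo by rw [← hT]; ring, show lo + T = hi by rw [← hT]; ring] at this
    exact this
  have e1 := shift 1 0 1 z.1 (by norm_num) one_ne_zero
  have e2 := shift (e - b) b e z.2 rfl hL
  simp only [div_one] at e1
  have cK : Continuous fun s : ℝ × ℝ => cosKernel (e - b) (z - s) ^ n :=
    ((continuous_cosKernel _).comp (continuous_const.sub continuous_id)).pow n
  have cK0 : Continuous fun s : ℝ × ℝ => cosKernel (e - b) s ^ n := (continuous_cosKernel _).pow n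
  rw [cosMass, setIntegral_box_eq_iterated hbe.le cK,
    setIntegral_box_eq_iterated hbe.le cK0]
  simp only [cosKernel, mul_pow, Prod.fst_sub, Prod.snd_sub, intervalIntegral.integral_const_mul,
    intervalIntegral.integral_mul_const]
  rw [e1, e2]

/-- The normalised Fourier coefficients of the convolution of `v` with `cosKernel ^ n`. -/
noncomputable def cosCoeff (b e : ℝ) (n : ℕ) (v : ℝ × ℝ → ℝ) (j : ℕ × ℕ) : ℂ :=
  ((cosMass b e n)⁻¹ : ℝ) *
    ((((2 * n).choose j.1 : ℂ) / 4 ^ n * (((2 * n).choose j.2 : ℂ) / 4 ^ n)) *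
    ∫ s in Icc (0 : ℝ) 1 ×ˢ Icc b e, (v s : ℂ) *
      Complex.exp (-(Complex.I * (cosFreqFst n j * s.1 + cosFreqSnd (e - b) n j * s.2))))

/-- The mean of `v` on the box weighted by the peak kernel `cosKernel ^ n` centred at `z`. -/
noncomputable def cosMean (b e : ℝ) (n : ℕ) (v : ℝ × ℝ → ℝ) (z : ℝ × ℝ) : ℝ :=
  (cosMass b e n)⁻¹ * ∫ s in Icc (0 : ℝ) 1 ×ˢ Icc b e, cosKernel (e - b) (z - s) ^ n * v s

lemma heatSum_cosCoeff (b e : ℝ) (n : ℕ) {v : ℝ × ℝ → ℝ} (hv : Continuous v) (z : ℝ × ℝ) :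
    heatSum (cosIndex n) (cosFreqFst n) (cosFreqSnd (e - b) n) (cosCoeff b e n v) 0 z.1 z.2 =
      cosMean b e n v z := by
  rw [← Complex.ofReal_re (cosMean b e n v z), heatSum]
  congr 1
  rw [cosMean, Complex.ofReal_mul, ← integral_complex_ofReal]
  simp_rw [Complex.ofReal_mul, cosKernel_pow_eq_sum, Finset.sum_mul]
  rw [integral_finsetSum, Finset.mul_sum]
  · refine Finset.sum_congr rfl fun j _ => ?_
    rw [cosCoeff, mul_assoc, mul_assoc, ← integral_mul_const, ← integral_const_mul]
    congr 2
    ext s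
    have hexp : Complex.exp (-(Complex.I * (cosFreqFst n j * s.1 +
        cosFreqSnd (e - b) n j * s.2))) * Complex.exp (-((cosFreqFst n j : ℂ) ^ 2 +
        (cosFreqSnd (e - b) n j : ℂ) ^ 2) * (0 : ℝ) + Complex.I * (cosFreqFst n j * z.1 +
        cosFreqSnd (e - b) n j * z.2)) = Complex.exp (Complex.I * (cosFreqFst n j * (z - s).1 +
        cosFreqSnd (e - b) n j * (z - s).2)) := by
      rw [← Complex.exp_add]
      congr 1
      simp only [Prod.fst_sub, Prod.snd_sub]
      push_cast
      ring
    rw [← hexp]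
    ring
  · intro j _
    exact Continuous.integrableOn_box (by fun_prop)

lemma restrict_box_eq (b e : ℝ) : (volume : Measure (ℝ × ℝ)).restrict (Icc 0 1 ×ˢ Icc b e) =
    volume.restrict (Ioo 0 1 ×ˢ Ioo b e) := by
  rw [Measure.volume_eq_prod, ← Measure.prod_restrict, ← Measure.prod_restrict,
    Measure.restrict_congr_set Ioo_ae_eq_Icc, Measure.restrict_congr_set Ioo_ae_eq_Icc]

lemma abs_cosMean_le {b e M : ℝ} (hbe : b < e) (n : ℕ) {v : ℝ × ℝ → ℝ} (hv : Continuous v)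
    (hM : ∀ s ∈ Icc (0 : ℝ) 1 ×ˢ Icc b e, |v s| ≤ M) (z : ℝ × ℝ) :
    |cosMean b e n v z| ≤ M := by
  have hM0 : 0 ≤ M := (abs_nonneg _).trans
    (hM (0, b) ⟨⟨le_rfl, zero_le_one⟩, ⟨le_rfl, hbe.le⟩⟩)
  have cK : Continuous fun s : ℝ × ℝ => cosKernel (e - b) (z - s) ^ n :=
    ((continuous_cosKernel _).comp (continuous_const.sub continuous_id)).pow n
  have hm : 0 ≤ cosMass b e n := integral_nonneg fun s => pow_nonneg (cosKernel_nonneg _ _) n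
  have h1 : |∫ s in Icc (0 : ℝ) 1 ×ˢ Icc b e, cosKernel (e - b) (z - s) ^ n * v s| ≤
      cosMass b e n * M := by
    rw [← setIntegral_cosKernel hbe n z, ← integral_mul_const]
    refine (abs_integral_le_integral_abs).trans ?_
    refine setIntegral_mono_on (cK.mul hv).abs.integrableOn_box
      (cK.mul continuous_const).integrableOn_box
      (measurableSet_Icc.prod measurableSet_Icc) fun s hs => ?_
    rw [abs_mul, abs_of_nonneg (pow_nonneg (cosKernel_nonneg _ _) n)]
    exact mul_le_mul_of_nonneg_left (hM s hs) (pow_nonneg (cosKernel_nonneg _ _) n)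
  rw [cosMean, abs_mul, abs_of_nonneg (inv_nonneg.2 hm)]
  calc _ ≤ (cosMass b e n)⁻¹ * (cosMass b e n * M) :=
        mul_le_mul_of_nonneg_left h1 (inv_nonneg.2 hm)
    _ = ((cosMass b e n)⁻¹ * cosMass b e n) * M := by ring
    _ ≤ 1 * M := mul_le_mul_of_nonneg_right inv_mul_le_one hM0
    _ = M := one_mul M

lemma cos_pi_sq_lt_one {t : ℝ} (h1 : -1 < t) (h2 : t < 1) (h0 : t ≠ 0) :
    Real.cos (Real.pi * t) ^ 2 < 1 := by
  have : Real.sin (Real.pi * t) ≠ 0 := by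
    rcases h0.lt_or_gt with h | h
    · exact (Real.sin_neg_of_neg_of_neg_pi_lt (by nlinarith [Real.pi_pos])
        (by nlinarith [Real.pi_pos])).ne
    · exact (Real.sin_pos_of_pos_of_lt_pi (by nlinarith [Real.pi_pos])
        (by nlinarith [Real.pi_pos])).ne'
  rw [Real.cos_sq']
  have := sq_pos_of_ne_zero this
  linarith

lemma cosKernel_lt {L : ℝ} (hL : 0 < L) {z : ℝ × ℝ} (h1 : |z.1| < 1) (h2 : |z.2| < L)
    (hz : z ≠ 0) : cosKernel L z < cosKernel L 0 := by
  have h3 : -1 < z.2 / L := by rw [lt_div_iff₀ hL]; linarith [(abs_lt.1 h2).1]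
  have h4 : z.2 / L < 1 := by rw [div_lt_iff₀ hL]; linarith [(abs_lt.1 h2).2]
  have a1 := Real.cos_sq_le_one (Real.pi * z.1)
  have a2 := Real.cos_sq_le_one (Real.pi * (z.2 / L))
  have b1 := sq_nonneg (Real.cos (Real.pi * z.1))
  have b2 := sq_nonneg (Real.cos (Real.pi * (z.2 / L)))
  simp only [cosKernel, Prod.fst_zero, Prod.snd_zero, zero_div, mul_zero, Real.cos_zero, one_pow,
    mul_one]
  by_cases h : z.1 = 0
  · have h' : z.2 / L ≠ 0 := div_ne_zero (fun h' => hz (Prod.ext h h')) hL.ne'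
    have := cos_pi_sq_lt_one h3 h4 h'
    nlinarith
  · have := cos_pi_sq_lt_one (abs_lt.1 h1).1 (abs_lt.1 h1).2 h
    nlinarith

lemma tendsto_cosMean {b e : ℝ} (hbe : b < e) {v : ℝ × ℝ → ℝ} (hv : Continuous v) {z : ℝ × ℝ}
    (hz : z ∈ Ioo (0 : ℝ) 1 ×ˢ Ioo b e) :
    Tendsto (fun n => cosMean b e n v z) atTop (𝓝 (v z)) := by
  have h_int : z ∈ closure (interior (Icc (0 : ℝ) 1 ×ˢ Icc b e)) := by
    rw [interior_prod_eq, interior_Icc, interior_Icc]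
    exact subset_closure hz
  have h := tendsto_setIntegral_pow_smul_of_unique_maximum_of_isCompact_of_continuousOn
    (μ := volume) (c := fun s => cosKernel (e - b) (z - s)) (g := v)
    (isCompact_Icc.prod isCompact_Icc)
    ((continuous_cosKernel _).comp (continuous_const.sub continuous_id)).continuousOn
    (fun s hs hsz => ?_) (fun s _ => cosKernel_nonneg _ _) ?_ h_int hv.continuousOn
  · simp only [setIntegral_cosKernel hbe, smul_eq_mul] at h
    exact h
  · simp only [sub_self]
    obtain ⟨⟨a1, a2⟩, a3, a4⟩ := hz
    obtain ⟨⟨b1, b2⟩, b3, b4⟩ := hs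
    refine cosKernel_lt (sub_pos.2 hbe) ?_ ?_ (sub_ne_zero.2 hsz.symm)
    · exact abs_lt.2 ⟨by simp only [Prod.fst_sub]; linarith, by simp only [Prod.fst_sub]; linarith⟩
    · exact abs_lt.2 ⟨by simp only [Prod.snd_sub]; linarith, by simp only [Prod.snd_sub]; linarith⟩
  · simp [cosKernel]

lemma exp_cosFreqFst (n : ℕ) (j : ℕ × ℕ) : Complex.exp (Complex.I * cosFreqFst n j) = 1 := by
  rw [Complex.exp_eq_one_iff]
  exact ⟨(j.1 : ℤ) - n, by simp only [cosFreqFst]; push_cast; ring⟩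

lemma exp_cosFreqSnd {b e : ℝ} (hbe : b < e) (n : ℕ) (j : ℕ × ℕ) :
    Complex.exp (Complex.I * (cosFreqSnd (e - b) n j * (e - b))) = 1 := by
  rw [Complex.exp_eq_one_iff]
  refine ⟨(j.2 : ℤ) - n, ?_⟩
  have hL : ((e : ℂ) - b) ≠ 0 := by
    rw [← Complex.ofReal_sub]; exact Complex.ofReal_ne_zero.2 (sub_pos.2 hbe).ne'
  simp only [cosFreqSnd]
  push_cast
  field_simp

lemma hasDerivAt_mul_cexp {f : ℝ → ℝ} {f' x : ℝ} (hf : HasDerivAt f f' x) (m k : ℂ) :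
    HasDerivAt (fun s : ℝ => (f s : ℂ) * Complex.exp (-(m * s + k)))
      (f' * Complex.exp (-(m * x + k)) - m * (f x * Complex.exp (-(m * x + k)))) x := by
  have h1 : HasDerivAt (fun s : ℝ => -(m * (s : ℂ) + k)) (-(m * 1)) x :=
    ((Complex.ofRealCLM.hasDerivAt.const_mul m).add_const k).neg
  refine (hf.ofReal_comp.mul h1.cexp).congr_deriv ?_
  ring

lemma integral_deriv_mul_cexp_eq {f f' : ℝ → ℝ} {lo hi : ℝ} (hf : ∀ x, HasDerivAt f (f' x) x)
    (hc : Continuous f') (m k : ℂ) (hm : Complex.exp (m * (hi - lo)) = 1) (h : f lo = f hi) :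
    ∫ x in lo..hi, (f' x * Complex.exp (-(m * x + k)) -
      m * (f x * Complex.exp (-(m * x + k)))) = 0 := by
  have cf : Continuous f := continuous_iff_continuousAt.2 fun x => (hf x).continuousAt
  rw [intervalIntegral.integral_eq_sub_of_hasDerivAt (fun x _ => hasDerivAt_mul_cexp (hf x) m k)
    (by apply Continuous.intervalIntegrable; fun_prop), h, ← mul_sub]
  have : Complex.exp (-(m * lo + k)) = Complex.exp (-(m * hi + k)) := by
    rw [← mul_one (Complex.exp (-(m * hi + k))), ← hm, ← Complex.exp_add]
    congr 1; ring
  rw [this, sub_self, mul_zero]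

lemma cosCoeff_deriv_fst {b e : ℝ} (hbe : b < e) (n : ℕ) {v v' : ℝ × ℝ → ℝ} (cv : Continuous v)
    (cv' : Continuous v') (hv : ∀ x y, HasDerivAt (fun s => v (s, y)) (v' (x, y)) x)
    (hper : ∀ y, v (0, y) = v (1, y)) (j : ℕ × ℕ) :
    cosCoeff b e n v' j = Complex.I * cosFreqFst n j * cosCoeff b e n v j := by
  have key : ∫ s in Icc (0 : ℝ) 1 ×ˢ Icc b e, ((v' s : ℂ) * Complex.exp
      (-(Complex.I * (cosFreqFst n j * s.1 + cosFreqSnd (e - b) n j * s.2))) -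
      Complex.I * cosFreqFst n j * (v s * Complex.exp
      (-(Complex.I * (cosFreqFst n j * s.1 + cosFreqSnd (e - b) n j * s.2))))) = 0 := by
    rw [setIntegral_box_eq_iterated_swap hbe.le (by fun_prop)]
    refine (intervalIntegral.integral_congr fun y _ => ?_).trans
      intervalIntegral.integral_zero
    have := integral_deriv_mul_cexp_eq (lo := 0) (hi := 1) (fun x => hv x y) (by fun_prop)
      (Complex.I * cosFreqFst n j) (Complex.I * (cosFreqSnd (e - b) n j * y))
      (by simpa using exp_cosFreqFst n j) (hper y)
    simpa only [mul_add, mul_assoc] using this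
  rw [integral_sub (Continuous.integrableOn_box (by fun_prop))
    (Continuous.integrableOn_box (by fun_prop)), integral_const_mul, sub_eq_zero] at key
  rw [cosCoeff, key, cosCoeff]
  ring

lemma cosCoeff_deriv_snd {b e : ℝ} (hbe : b < e) (n : ℕ) {v v' : ℝ × ℝ → ℝ} (cv : Continuous v)
    (cv' : Continuous v') (hv : ∀ x y, HasDerivAt (fun s => v (x, s)) (v' (x, y)) y)
    (hper : ∀ x, v (x, b) = v (x, e)) (j : ℕ × ℕ) :
    cosCoeff b e n v' j = Complex.I * cosFreqSnd (e - b) n j * cosCoeff b e n v j := by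
  have key : ∫ s in Icc (0 : ℝ) 1 ×ˢ Icc b e, ((v' s : ℂ) * Complex.exp
      (-(Complex.I * (cosFreqFst n j * s.1 + cosFreqSnd (e - b) n j * s.2))) -
      Complex.I * cosFreqSnd (e - b) n j * (v s * Complex.exp
      (-(Complex.I * (cosFreqFst n j * s.1 + cosFreqSnd (e - b) n j * s.2))))) = 0 := by
    rw [setIntegral_box_eq_iterated hbe.le (by fun_prop)]
    refine (intervalIntegral.integral_congr fun x _ => ?_).trans
      intervalIntegral.integral_zero
    have := integral_deriv_mul_cexp_eq (lo := b) (hi := e) (fun y => hv x y) (by fun_prop)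
      (Complex.I * cosFreqSnd (e - b) n j) (Complex.I * (cosFreqFst n j * x))
      (by simpa only [mul_assoc] using exp_cosFreqSnd hbe n j) (hper x)
    simpa only [mul_add, mul_assoc, add_comm (Complex.I * ((cosFreqSnd (e - b) n j : ℂ) * _))]
      using this
  rw [integral_sub (Continuous.integrableOn_box (by fun_prop))
    (Continuous.integrableOn_box (by fun_prop)), integral_const_mul, sub_eq_zero] at key
  rw [cosCoeff, key, cosCoeff]
  ring

lemma cosCoeff_add {b e : ℝ} (n : ℕ) {v v' : ℝ × ℝ → ℝ} (cv : Continuous v)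
    (cv' : Continuous v') (j : ℕ × ℕ) :
    cosCoeff b e n (fun z => v z + v' z) j = cosCoeff b e n v j + cosCoeff b e n v' j := by
  unfold cosCoeff
  simp_rw [Complex.ofReal_add, add_mul]
  rw [integral_add (Continuous.integrableOn_box (by fun_prop))
    (Continuous.integrableOn_box (by fun_prop))]
  ring

lemma cosCoeff_sub {b e : ℝ} (n : ℕ) {v v' : ℝ × ℝ → ℝ} (cv : Continuous v)
    (cv' : Continuous v') (j : ℕ × ℕ) :
    cosCoeff b e n (fun z => v z - v' z) j = cosCoeff b e n v j - cosCoeff b e n v' j := by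
  unfold cosCoeff
  simp_rw [Complex.ofReal_sub, sub_mul]
  rw [integral_sub (Continuous.integrableOn_box (by fun_prop))
    (Continuous.integrableOn_box (by fun_prop))]
  ring

lemma continuous_cosMean (b e : ℝ) (n : ℕ) {v : ℝ × ℝ → ℝ} (hv : Continuous v) :
    Continuous (cosMean b e n v) := by
  have h : cosMean b e n v = fun z : ℝ × ℝ => heatSum (cosIndex n) (cosFreqFst n)
      (cosFreqSnd (e - b) n) (cosCoeff b e n v) 0 z.1 z.2 :=
    funext fun z => (heatSum_cosCoeff b e n hv z).symm
  have h1 : Continuous fun z : ℝ × ℝ => ((0 : ℝ), z.1, z.2) := by fun_prop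
  have h2 := (continuous_heatSum (J := cosIndex n) (α := cosFreqFst n)
    (β := cosFreqSnd (e - b) n) (cosCoeff b e n v)).comp h1
  rw [h]
  exact h2

lemma tendsto_setIntegral_cosMean {b e p : ℝ} (hp : 0 < p) (hbe : b < e) {v : ℝ × ℝ → ℝ}
    (hv : Continuous v) :
    Tendsto (fun n => ∫ z in Icc (0 : ℝ) 1 ×ˢ Icc b e, |cosMean b e n v z| ^ p) atTop
      (𝓝 (∫ z in Icc (0 : ℝ) 1 ×ˢ Icc b e, |v z| ^ p)) := by
  obtain ⟨M, hM⟩ := (isCompact_Icc.prod isCompact_Icc :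
    IsCompact (Icc (0 : ℝ) 1 ×ˢ Icc b e)).exists_bound_of_continuousOn hv.continuousOn
  refine tendsto_integral_of_dominated_convergence (fun _ => M ^ p) ?_ ?_ ?_ ?_
  · exact fun n => ((continuous_cosMean b e n hv).abs.rpow_const
      fun _ => Or.inr hp.le).aestronglyMeasurable
  · exact integrableOn_const (volume_box_ne_top b e)
  · refine fun n => Eventually.of_forall fun z => ?_
    rw [Real.norm_eq_abs, abs_of_nonneg (Real.rpow_nonneg (abs_nonneg _) p)]
    exact Real.rpow_le_rpow (abs_nonneg _) (abs_cosMean_le hbe n hv hM z) hp.le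
  · rw [restrict_box_eq]
    filter_upwards [ae_restrict_mem (measurableSet_Ioo.prod measurableSet_Ioo)] with z hz
    exact (tendsto_cosMean hbe hv hz).abs.rpow_const (Or.inr hp.le)

/-- `f` is continuously differentiable on the plane with partial derivatives `fx` and `fy`. -/
structure HasContPartials (f fx fy : ℝ × ℝ → ℝ) : Prop where
  cont : Continuous f
  cont_fst : Continuous fx
  cont_snd : Continuous fy
  deriv_fst : ∀ x y, HasDerivAt (fun s => f (s, y)) (fx (x, y)) x
  deriv_snd : ∀ x y, HasDerivAt (fun s => f (x, s)) (fy (x, y)) y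

/-- Korn's inequality for continuously differentiable fields on a flat torus. -/
lemma exists_korn_torus {p : ℝ} (hp : 1 < p) :
    ∃ K : ℝ, 0 < K ∧ ∀ (b e : ℝ) (v₁ v₂ v₁x v₁y v₂x v₂y : ℝ × ℝ → ℝ), b < e →
      HasContPartials v₁ v₁x v₁y → HasContPartials v₂ v₂x v₂y →
      (∀ y, v₁ (0, y) = v₁ (1, y)) → (∀ y, v₂ (0, y) = v₂ (1, y)) →
      (∀ x, v₁ (x, b) = v₁ (x, e)) → (∀ x, v₂ (x, b) = v₂ (x, e)) →
      ∫ z in Icc (0 : ℝ) 1 ×ˢ Icc b e, |v₂x z - v₁y z| ^ p ≤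
        K * ((∫ z in Icc (0 : ℝ) 1 ×ˢ Icc b e, |v₁x z| ^ p) +
          (∫ z in Icc (0 : ℝ) 1 ×ˢ Icc b e, |v₂y z| ^ p) +
          ∫ z in Icc (0 : ℝ) 1 ×ˢ Icc b e, |v₁y z + v₂x z| ^ p) := by
  have hp0 : 0 < p := by linarith
  obtain ⟨K, hK, h⟩ := exists_korn_trigonometric hp
  refine ⟨K, hK, ?_⟩
  intro b e v₁ v₂ v₁x v₁y v₂x v₂y hbe ⟨c₁, c₁x, c₁y, d₁x, d₁y⟩ ⟨c₂, c₂x, c₂y, d₂x, d₂y⟩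
    p₁ p₂ q₁ q₂
  have cw : Continuous fun z => v₂x z - v₁y z := c₂x.sub c₁y
  have cs : Continuous fun z => v₁y z + v₂x z := c₁y.add c₂x
  refine le_of_tendsto_of_tendsto' (tendsto_setIntegral_cosMean hp0 hbe cw)
    ((((tendsto_setIntegral_cosMean hp0 hbe c₁x).add
      (tendsto_setIntegral_cosMean hp0 hbe c₂y)).add
      (tendsto_setIntegral_cosMean hp0 hbe cs)).const_mul K) fun n => ?_
  have key := h (ℕ × ℕ) (cosIndex n) (cosFreqFst n) (cosFreqSnd (e - b) n)
    (cosCoeff b e n v₁) (cosCoeff b e n v₂) b e hbe.le (exp_cosFreqFst n)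
    (by simpa using exp_cosFreqSnd hbe n)
  have h0 : ∀ z : ℝ × ℝ, strainField (cosIndex n) (cosFreqFst n) (cosFreqSnd (e - b) n)
      (cosCoeff b e n v₁) (cosCoeff b e n v₂) 0 z.1 z.2 0 =
      cosMean b e n (fun z => v₂x z - v₁y z) z := by
    intro z
    rw [← heatSum_cosCoeff b e n cw, strainField]
    congr 1
    ext j
    rw [cosCoeff_sub n c₂x c₁y, cosCoeff_deriv_fst hbe n c₂ c₂x d₂x p₂,
      cosCoeff_deriv_snd hbe n c₁ c₁y d₁y q₁]
    simp [strainCoeff]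
  have h1 : ∀ z : ℝ × ℝ, strainField (cosIndex n) (cosFreqFst n) (cosFreqSnd (e - b) n)
      (cosCoeff b e n v₁) (cosCoeff b e n v₂) 0 z.1 z.2 1 = cosMean b e n v₁x z := by
    intro z
    rw [← heatSum_cosCoeff b e n c₁x, strainField]
    congr 1
    ext j
    rw [cosCoeff_deriv_fst hbe n c₁ c₁x d₁x p₁]
    simp [strainCoeff]
  have h2 : ∀ z : ℝ × ℝ, strainField (cosIndex n) (cosFreqFst n) (cosFreqSnd (e - b) n)
      (cosCoeff b e n v₁) (cosCoeff b e n v₂) 0 z.1 z.2 2 = cosMean b e n v₂y z := by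
    intro z
    rw [← heatSum_cosCoeff b e n c₂y, strainField]
    congr 1
    ext j
    rw [cosCoeff_deriv_snd hbe n c₂ c₂y d₂y q₂]
    simp [strainCoeff]
  have h3 : ∀ z : ℝ × ℝ, strainField (cosIndex n) (cosFreqFst n) (cosFreqSnd (e - b) n)
      (cosCoeff b e n v₁) (cosCoeff b e n v₂) 0 z.1 z.2 3 =
      cosMean b e n (fun z => v₁y z + v₂x z) z := by
    intro z
    rw [← heatSum_cosCoeff b e n cs, strainField]
    congr 1
    ext j
    rw [cosCoeff_add n c₁y c₂x, cosCoeff_deriv_fst hbe n c₂ c₂x d₂x p₂,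
      cosCoeff_deriv_snd hbe n c₁ c₁y d₁y q₁]
    simp [strainCoeff]
  simp only [h0, h1, h2, h3] at key
  have cm : ∀ {v : ℝ × ℝ → ℝ}, Continuous v → Continuous fun z => |cosMean b e n v z| ^ p :=
    fun hv => (continuous_cosMean b e n hv).abs.rpow_const fun _ => Or.inr hp0.le
  have c12 : Continuous fun z => |cosMean b e n v₁x z| ^ p + |cosMean b e n v₂y z| ^ p :=
    (cm c₁x).add (cm c₂y)
  rw [integral_add c12.integrableOn_box (cm cs).integrableOn_box,
    integral_add (cm c₁x).integrableOn_box (cm c₂y).integrableOn_box] at key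
  exact key

/-- Higher order reflection of `f` across the line `y = a`. -/
noncomputable def reflExt (a : ℝ) (c : Fin 3 → ℝ) (f : ℝ × ℝ → ℝ) (z : ℝ × ℝ) : ℝ :=
  if a ≤ z.2 then f z else ∑ k : Fin 3, c k * f (z.1, a + (k + 1) * (a - z.2))

lemma reflExt_of_le {a : ℝ} {c : Fin 3 → ℝ} {f : ℝ × ℝ → ℝ} {z : ℝ × ℝ} (h : a ≤ z.2) :
    reflExt a c f z = f z := if_pos h

lemma reflExt_of_lt {a : ℝ} {c : Fin 3 → ℝ} {f : ℝ × ℝ → ℝ} {z : ℝ × ℝ} (h : z.2 < a) :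
    reflExt a c f z = ∑ k : Fin 3, c k * f (z.1, a + (k + 1) * (a - z.2)) := if_neg h.not_ge

lemma reflExt_add (a : ℝ) (c : Fin 3 → ℝ) (f g : ℝ × ℝ → ℝ) (z : ℝ × ℝ) :
    reflExt a c (fun z => f z + g z) z = reflExt a c f z + reflExt a c g z := by
  unfold reflExt
  split_ifs
  · rfl
  · simp only [mul_add, Finset.sum_add_distrib]

lemma continuous_reflExt {a : ℝ} {c : Fin 3 → ℝ} (hc : ∑ k, c k = 1) {f : ℝ × ℝ → ℝ}
    (hf : Continuous f) : Continuous (reflExt a c f) := by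
  refine Continuous.if_le hf (by fun_prop) continuous_const continuous_snd fun z hz => ?_
  rw [← hz]
  simp only [sub_self, mul_zero, add_zero]
  rw [← Finset.sum_mul, hc, one_mul, hz]

lemma HasContPartials.reflExt {a : ℝ} {c c' : Fin 3 → ℝ} (hc : ∑ k, c k = 1)
    (hc' : ∑ k, c' k = 1) (hcc : ∀ k, c' k = -((k + 1) * c k)) {f fx fy : ℝ × ℝ → ℝ}
    (hf : HasContPartials f fx fy) :
    HasContPartials (reflExt a c f) (reflExt a c fx) (reflExt a c' fy) where
  cont := continuous_reflExt hc hf.cont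
  cont_fst := continuous_reflExt hc hf.cont_fst
  cont_snd := continuous_reflExt hc' hf.cont_snd
  deriv_fst x y := by
    rcases le_or_gt a y with h | h
    · simp only [reflExt_of_le (z := (_, y)) h]
      exact hf.deriv_fst x y
    · simp only [reflExt_of_lt (z := (_, y)) h]
      exact HasDerivAt.fun_sum fun k _ => (hf.deriv_fst x _).const_mul (c k)
  deriv_snd x y := by
    have hline : Continuous fun s : ℝ => (x, s) := by fun_prop
    refine hasDerivAt_of_hasDerivAt_of_ne' (x := a) (f := fun s => _root_.reflExt a c f (x, s))
      (g := fun s => _root_.reflExt a c' fy (x, s)) (fun s hs => ?_)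
      ((continuous_reflExt hc hf.cont).comp hline).continuousAt
      ((continuous_reflExt hc' hf.cont_snd).comp hline).continuousAt y
    rcases hs.lt_or_gt with h | h
    · rw [reflExt_of_lt (z := (x, s)) h]
      have h1 : HasDerivAt (fun s => ∑ k : Fin 3, c k * f (x, a + (k + 1) * (a - s)))
          (∑ k : Fin 3, c' k * fy (x, a + (k + 1) * (a - s))) s := by
        refine HasDerivAt.fun_sum fun k _ => ?_
        have h2 : HasDerivAt (fun s : ℝ => a + ((k : ℝ) + 1) * (a - s)) (-(k + 1)) s := by
          simpa using (((hasDerivAt_id s).const_sub a).const_mul ((k : ℝ) + 1)).const_add a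
        refine (((hf.deriv_snd x _).comp s h2).const_mul (c k)).congr_deriv ?_
        rw [hcc]
        ring
      refine h1.congr_of_eventuallyEq ?_
      filter_upwards [Iio_mem_nhds h] with t ht
      exact reflExt_of_lt (z := (x, t)) ht
    · rw [reflExt_of_le (z := (x, s)) h.le]
      refine (hf.deriv_snd x s).congr_of_eventuallyEq ?_
      filter_upwards [Ioi_mem_nhds h] with t ht
      exact reflExt_of_le (z := (x, t)) (le_of_lt ht)

lemma abs_sum_three_rpow_le {p : ℝ} (hp : 0 < p) {c A : Fin 3 → ℝ} (hc : ∑ k, |c k| ≤ 65) :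
    |∑ k, c k * A k| ^ p ≤ 65 ^ p * ∑ k, |A k| ^ p := by
  obtain ⟨m, -, hm⟩ := Finset.exists_max_image Finset.univ (fun k => |A k|) Finset.univ_nonempty
  have h1 : |∑ k, c k * A k| ≤ 65 * |A m| :=
    calc _ ≤ ∑ k, |c k| * |A m| := (Finset.abs_sum_le_sum_abs _ _).trans
          (Finset.sum_le_sum fun k hk => by
            rw [abs_mul]; exact mul_le_mul_of_nonneg_left (hm k hk) (abs_nonneg _))
      _ ≤ 65 * |A m| := by
          rw [← Finset.sum_mul]; exact mul_le_mul_of_nonneg_right hc (abs_nonneg _)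
  calc _ ≤ (65 * |A m|) ^ p := Real.rpow_le_rpow (abs_nonneg _) h1 hp.le
    _ = 65 ^ p * |A m| ^ p := Real.mul_rpow (by norm_num) (abs_nonneg _)
    _ ≤ _ := mul_le_mul_of_nonneg_left (Finset.single_le_sum (f := fun k => |A k| ^ p)
        (fun k _ => Real.rpow_nonneg (abs_nonneg _) _) (Finset.mem_univ m)) (by positivity)

lemma setIntegral_box_comp_refl_le {a M : ℝ} (hM : 0 < M) {g : ℝ × ℝ → ℝ} (hg : Continuous g)
    (hg0 : ∀ z, 0 ≤ g z) (k : Fin 3) :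
    ∫ z in Icc (0 : ℝ) 1 ×ˢ Icc (a - M) a, g (z.1, a + (k + 1) * (a - z.2)) ≤
      ∫ z in Icc (0 : ℝ) 1 ×ˢ Icc a (a + 3 * M), g z := by
  have cx : ∀ x, Continuous fun y => g (x, y) := fun x => by fun_prop
  rw [setIntegral_box_eq_iterated (by linarith) (by fun_prop),
    setIntegral_box_eq_iterated (by linarith) hg]
  refine intervalIntegral.integral_mono_on zero_le_one
    (intervalIntegral.continuous_parametric_intervalIntegral_of_continuous' (by fun_prop) _ _
      |>.intervalIntegrable _ _)
    (intervalIntegral.continuous_parametric_intervalIntegral_of_continuous' (by fun_prop) _ _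
      |>.intervalIntegrable _ _) fun x _ => ?_
  have hk0 : (0 : ℝ) ≤ k := Nat.cast_nonneg _
  have hk2 : (k : ℝ) ≤ 2 := by exact_mod_cast Nat.lt_succ_iff.1 k.2
  have h1 := intervalIntegral.integral_comp_sub_mul (fun y => g (x, y))
    (a := a - M) (b := a) (c := (k : ℝ) + 1) (by positivity) (a + (k + 1) * a)
  have h2 : ∫ y in (a - M)..a, g (x, a + (k + 1) * (a - y)) =
      ∫ y in (a - M)..a, g (x, a + (k + 1) * a - (k + 1) * y) := by
    congr 1; ext y; congr 2; ring
  rw [h2, h1, smul_eq_mul]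
  have h3 : ∫ y in (a + (k + 1) * a - (k + 1) * a)..(a + (k + 1) * a - (k + 1) * (a - M)),
      g (x, y) ≤ ∫ y in a..(a + 3 * M), g (x, y) := by
    refine intervalIntegral.integral_mono_interval (by linarith) (by nlinarith) (by nlinarith)
      (Eventually.of_forall fun y => hg0 _) ((cx x).intervalIntegrable _ _)
  have h4 : 0 ≤ ∫ y in a..(a + 3 * M), g (x, y) :=
    intervalIntegral.integral_nonneg (by linarith) fun y _ => hg0 _
  calc _ ≤ ((k : ℝ) + 1)⁻¹ * ∫ y in a..(a + 3 * M), g (x, y) :=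
        mul_le_mul_of_nonneg_left h3 (by positivity)
    _ ≤ 1 * ∫ y in a..(a + 3 * M), g (x, y) :=
        mul_le_mul_of_nonneg_right (inv_le_one_of_one_le₀ (by linarith)) h4
    _ = _ := one_mul _

lemma setIntegral_reflExt_le {p a M : ℝ} (hp : 0 < p) (hM : 0 < M) {c : Fin 3 → ℝ}
    (hc : ∑ k, c k = 1) (hc' : ∑ k, |c k| ≤ 65) {f : ℝ × ℝ → ℝ} (hf : Continuous f) :
    ∫ z in Icc (0 : ℝ) 1 ×ˢ Icc (a - M) (a + M), |reflExt a c f z| ^ p ≤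
      (1 + 3 * 65 ^ p) * ∫ z in Icc (0 : ℝ) 1 ×ˢ Icc a (a + 3 * M), |f z| ^ p := by
  have cP : ∀ {h : ℝ × ℝ → ℝ}, Continuous h → Continuous fun z => |h z| ^ p :=
    fun hh => hh.abs.rpow_const fun _ => Or.inr hp.le
  set I := ∫ z in Icc (0 : ℝ) 1 ×ˢ Icc a (a + 3 * M), |f z| ^ p
  have hsplit : Icc (0 : ℝ) 1 ×ˢ Icc (a - M) (a + M) =
      Icc (0 : ℝ) 1 ×ˢ Ico (a - M) a ∪ Icc (0 : ℝ) 1 ×ˢ Icc a (a + M) := by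
    rw [← prod_union, Ico_union_Icc_eq_Icc (by linarith) (by linarith)]
  have hdisj : Disjoint (Icc (0 : ℝ) 1 ×ˢ Ico (a - M) a) (Icc (0 : ℝ) 1 ×ˢ Icc a (a + M)) :=
    disjoint_prod.2 (Or.inr (disjoint_left.2 fun y h1 h2 => (h1.2.trans_le h2.1).false))
  have cR := cP (continuous_reflExt (a := a) hc hf)
  have hsub : Icc (0 : ℝ) 1 ×ˢ Ico (a - M) a ⊆ Icc (0 : ℝ) 1 ×ˢ Icc (a - M) a :=
    prod_mono_right Ico_subset_Icc_self
  rw [hsplit, setIntegral_union hdisj (measurableSet_Icc.prod measurableSet_Icc)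
    (cR.integrableOn_box.mono_set hsub) cR.integrableOn_box]
  have h1 : ∫ z in Icc (0 : ℝ) 1 ×ˢ Icc a (a + M), |reflExt a c f z| ^ p ≤ I := by
    rw [setIntegral_congr_fun (g := fun z => |f z| ^ p) (measurableSet_Icc.prod measurableSet_Icc)
      fun z hz => by simp only [reflExt_of_le hz.2.1]]
    refine setIntegral_mono_set (cP hf).integrableOn_box (Eventually.of_forall fun z => ?_)
      (prod_mono_right (Icc_subset_Icc_right (by linarith))).eventuallyLE
    exact Real.rpow_nonneg (abs_nonneg _) _
  have cg : ∀ k : Fin 3, Continuous fun z : ℝ × ℝ => |f (z.1, a + (k + 1) * (a - z.2))| ^ p :=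
    fun k => cP (by fun_prop)
  have cs : Continuous fun z : ℝ × ℝ => 65 ^ p *
      ∑ k : Fin 3, |f (z.1, a + (k + 1) * (a - z.2))| ^ p :=
    continuous_const.mul (continuous_finsetSum _ fun k _ => cg k)
  have h2 : ∫ z in Icc (0 : ℝ) 1 ×ˢ Ico (a - M) a, |reflExt a c f z| ^ p ≤ 3 * 65 ^ p * I :=
    calc _ ≤ ∫ z in Icc (0 : ℝ) 1 ×ˢ Ico (a - M) a, 65 ^ p *
          ∑ k : Fin 3, |f (z.1, a + (k + 1) * (a - z.2))| ^ p := by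
          refine setIntegral_mono_on (cR.integrableOn_box.mono_set hsub)
            (cs.integrableOn_box.mono_set hsub) (measurableSet_Icc.prod measurableSet_Ico)
            fun z hz => ?_
          rw [reflExt_of_lt hz.2.2]
          exact abs_sum_three_rpow_le hp hc'
      _ ≤ ∫ z in Icc (0 : ℝ) 1 ×ˢ Icc (a - M) a, 65 ^ p *
          ∑ k : Fin 3, |f (z.1, a + (k + 1) * (a - z.2))| ^ p :=
          setIntegral_mono_set cs.integrableOn_box
            (Eventually.of_forall fun z => mul_nonneg (by positivity)
              (Finset.sum_nonneg fun k _ => Real.rpow_nonneg (abs_nonneg _) _)) hsub.eventuallyLE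
      _ = 65 ^ p * ∑ k : Fin 3, ∫ z in Icc (0 : ℝ) 1 ×ˢ Icc (a - M) a,
          |f (z.1, a + (k + 1) * (a - z.2))| ^ p := by
          rw [integral_const_mul, integral_finsetSum _ fun k _ => (cg k).integrableOn_box]
      _ ≤ 65 ^ p * ∑ _k : Fin 3, I := by
          refine mul_le_mul_of_nonneg_left (Finset.sum_le_sum fun k _ => ?_) (by positivity)
          exact setIntegral_box_comp_refl_le hM (cP hf)
            (fun z => Real.rpow_nonneg (abs_nonneg _) _) k
      _ = _ := by simp; ring
  linarith

/-- Korn's inequality on the half-strip for fields which vanish for large heights. -/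
lemma exists_korn_of_vanishing {p : ℝ} (hp : 1 < p) :
    ∃ K : ℝ, 0 < K ∧ ∀ (a M : ℝ) (v₁ v₂ v₁x v₁y v₂x v₂y : ℝ × ℝ → ℝ), 0 < M →
      HasContPartials v₁ v₁x v₁y → HasContPartials v₂ v₂x v₂y →
      (∀ y, v₁ (0, y) = v₁ (1, y)) → (∀ y, v₂ (0, y) = v₂ (1, y)) →
      (∀ x y, a + M ≤ y → v₁ (x, y) = 0) → (∀ x y, a + M ≤ y → v₂ (x, y) = 0) →
      ∫ z in Icc (0 : ℝ) 1 ×ˢ Icc a (a + M), |v₂x z - v₁y z| ^ p ≤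
        K * ((∫ z in Icc (0 : ℝ) 1 ×ˢ Icc a (a + 3 * M), |v₁x z| ^ p) +
          (∫ z in Icc (0 : ℝ) 1 ×ˢ Icc a (a + 3 * M), |v₂y z| ^ p) +
          ∫ z in Icc (0 : ℝ) 1 ×ˢ Icc a (a + 3 * M), |v₁y z + v₂x z| ^ p) := by
  have hp0 : 0 < p := by linarith
  obtain ⟨K, hK, h⟩ := exists_korn_torus hp
  refine ⟨K * (1 + 3 * 65 ^ p), by positivity, ?_⟩
  intro a M v₁ v₂ v₁x v₁y v₂x v₂y hM hv₁ hv₂ p₁ p₂ z₁ z₂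
  let c₁ : Fin 3 → ℝ := ![6, -8, 3]
  let c₂ : Fin 3 → ℝ := ![-6, 16, -9]
  let c₃ : Fin 3 → ℝ := ![6, -32, 27]
  have s₁ : ∑ k, c₁ k = 1 := by simp [c₁, Fin.sum_univ_three]; norm_num
  have s₂ : ∑ k, c₂ k = 1 := by simp [c₂, Fin.sum_univ_three]; norm_num
  have s₃ : ∑ k, c₃ k = 1 := by simp [c₃, Fin.sum_univ_three]; norm_num
  have t₁ : ∑ k, |c₁ k| ≤ 65 := by simp [c₁, Fin.sum_univ_three]; norm_num
  have t₂ : ∑ k, |c₂ k| ≤ 65 := by simp [c₂, Fin.sum_univ_three]; norm_num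
  have t₃ : ∑ k, |c₃ k| ≤ 65 := by simp [c₃, Fin.sum_univ_three]; norm_num
  have r₁ : ∀ k : Fin 3, c₂ k = -((k + 1) * c₁ k) := by
    intro k; fin_cases k <;> simp [c₁, c₂] <;> norm_num
  have r₂ : ∀ k : Fin 3, c₃ k = -((k + 1) * c₂ k) := by
    intro k; fin_cases k <;> simp [c₂, c₃] <;> norm_num
  have per : ∀ (c : Fin 3 → ℝ) {v : ℝ × ℝ → ℝ}, (∀ y, v (0, y) = v (1, y)) →
      ∀ y, reflExt a c v (0, y) = reflExt a c v (1, y) := by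
    intro c v hv y
    unfold reflExt
    simp only [hv]
  have van : ∀ (c : Fin 3 → ℝ) {v : ℝ × ℝ → ℝ}, (∀ x y, a + M ≤ y → v (x, y) = 0) →
      ∀ x, reflExt a c v (x, a - M) = reflExt a c v (x, a + M) := by
    intro c v hv x
    rw [reflExt_of_lt (by simpa using hM), reflExt_of_le (by simpa using hM.le), hv _ _ le_rfl]
    refine Finset.sum_eq_zero fun k _ => ?_
    have hk0 : (0 : ℝ) ≤ k := Nat.cast_nonneg _
    rw [hv _ _ (by simp only; nlinarith), mul_zero]
  have key := h (a - M) (a + M) _ _ _ _ _ _ (by linarith) (hv₁.reflExt (a := a) s₁ s₂ r₁)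
    (hv₂.reflExt (a := a) s₂ s₃ r₂) (per c₁ p₁) (per c₂ p₂) (van c₁ z₁) (van c₂ z₂)
  have hw : ∫ z in Icc (0 : ℝ) 1 ×ˢ Icc a (a + M), |v₂x z - v₁y z| ^ p ≤
      ∫ z in Icc (0 : ℝ) 1 ×ˢ Icc (a - M) (a + M),
        |reflExt a c₂ v₂x z - reflExt a c₂ v₁y z| ^ p := by
    rw [setIntegral_congr_fun (g := fun z => |reflExt a c₂ v₂x z - reflExt a c₂ v₁y z| ^ p)
      (measurableSet_Icc.prod measurableSet_Icc)
      fun z hz => by simp only [reflExt_of_le hz.2.1]]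
    refine setIntegral_mono_set (Continuous.integrableOn_box (Continuous.rpow_const
      ((continuous_reflExt s₂ hv₂.cont_fst).sub (continuous_reflExt s₂ hv₁.cont_snd)).abs
      fun _ => Or.inr hp0.le)) (Eventually.of_forall fun z => Real.rpow_nonneg (abs_nonneg _) _)
      (prod_mono_right (Icc_subset_Icc_left (by linarith))).eventuallyLE
  have e₁ := setIntegral_reflExt_le (a := a) hp0 hM s₁ t₁ hv₁.cont_fst
  have e₂ := setIntegral_reflExt_le (a := a) hp0 hM s₃ t₃ hv₂.cont_snd
  have e₃ := setIntegral_reflExt_le (a := a) hp0 hM s₂ t₂ (hv₁.cont_snd.add hv₂.cont_fst)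
  simp only [Pi.add_def, reflExt_add] at e₃
  refine (hw.trans key).trans ?_
  rw [mul_assoc]
  refine mul_le_mul_of_nonneg_left ?_ hK.le
  linarith

lemma add_rpow_le_two_rpow_mul {p A B : ℝ} (hp : 0 < p) (hA : 0 ≤ A) (hB : 0 ≤ B) :
    (A + B) ^ p ≤ 2 ^ p * (A ^ p + B ^ p) := by
  have h1 : A + B ≤ 2 * max A B := by linarith [le_max_left A B, le_max_right A B]
  have h2 : (A + B) ^ p ≤ 2 ^ p * max A B ^ p := by
    rw [← Real.mul_rpow (by norm_num) (le_max_of_le_left hA)]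
    exact Real.rpow_le_rpow (by positivity) h1 hp.le
  refine h2.trans (mul_le_mul_of_nonneg_left ?_ (by positivity))
  rcases max_cases A B with ⟨h, -⟩ | ⟨h, -⟩ <;> rw [h]
  · linarith [Real.rpow_nonneg hB p]
  · linarith [Real.rpow_nonneg hA p]

lemma integral_abs_rpow_le {p m Y : ℝ} (hp : 1 ≤ p) (hmY : m < Y) {g : ℝ → ℝ}
    (hg : Continuous g) :
    (∫ y in m..Y, |g y|) ^ p ≤ (Y - m) ^ (p - 1) * ∫ y in m..Y, |g y| ^ p := by
  have hℓ : 0 < Y - m := sub_pos.2 hmY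
  have hI : 0 ≤ ∫ y in m..Y, |g y| :=
    intervalIntegral.integral_nonneg hmY.le fun y _ => abs_nonneg _
  have cP : Continuous fun y => |g y| ^ p := hg.abs.rpow_const fun _ => Or.inr (by linarith)
  have h := (convexOn_rpow hp).map_set_average_le (μ := volume) (t := Icc m Y)
    (f := fun y => |g y|)
    (Real.continuous_rpow_const (by linarith)).continuousOn isClosed_Ici (by simpa using hmY)
    (by simp) (Eventually.of_forall fun y => abs_nonneg (g y))
    hg.abs.continuousOn.integrableOn_Icc cP.continuousOn.integrableOn_Icc
  rw [setAverage_eq, setAverage_eq, integral_Icc_eq_integral_Ioc, integral_Icc_eq_integral_Ioc,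
    ← intervalIntegral.integral_of_le hmY.le, ← intervalIntegral.integral_of_le hmY.le,
    Real.volume_real_Icc_of_le hmY.le, smul_eq_mul, smul_eq_mul,
    Real.mul_rpow (inv_nonneg.2 hℓ.le) hI, Real.inv_rpow hℓ.le] at h
  have hp0 : 0 < (Y - m) ^ p := Real.rpow_pos_of_pos hℓ p
  rw [inv_mul_le_iff₀ hp0] at h
  rw [Real.rpow_sub_one hℓ.ne']
  calc _ ≤ _ := h
    _ = _ := by ring

lemma rpow_abs_le_of_deriv {p m y N Y : ℝ} (hp : 1 < p) (hN : Y - m ≤ 2 * N) (hmy : m ≤ y)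
    (hyY : y ≤ Y) (hmY : m < Y) {f f' : ℝ → ℝ} (hf : ∀ y, HasDerivAt f (f' y) y)
    (hf' : Continuous f') :
    |f y| ^ p ≤ 2 ^ p * (|f m| ^ p + (2 * N) ^ (p - 1) * ∫ s in m..Y, |f' s| ^ p) := by
  have h1 : ∫ s in m..y, f' s = f y - f m :=
    intervalIntegral.integral_eq_sub_of_hasDerivAt (fun s _ => hf s) (hf'.intervalIntegrable _ _)
  have h2 : |f y - f m| ≤ ∫ s in m..Y, |f' s| := by
    rw [← h1]
    exact (intervalIntegral.abs_integral_le_integral_abs hmy).trans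
      (intervalIntegral.integral_mono_interval le_rfl hmy hyY
        (Eventually.of_forall fun s => abs_nonneg _) (hf'.abs.intervalIntegrable _ _))
  have h3 : |f y| ≤ |f m| + ∫ s in m..Y, |f' s| := by
    have := abs_add_le (f m) (f y - f m)
    rw [add_sub_cancel] at this
    linarith
  have hI : 0 ≤ ∫ s in m..Y, |f' s| := (abs_nonneg _).trans h2
  have hJ : 0 ≤ ∫ s in m..Y, |f' s| ^ p := intervalIntegral.integral_nonneg hmY.le
    fun s _ => Real.rpow_nonneg (abs_nonneg _) _
  refine (Real.rpow_le_rpow (abs_nonneg _) h3 (by linarith)).trans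
    ((add_rpow_le_two_rpow_mul (by linarith) (abs_nonneg _) hI).trans ?_)
  refine mul_le_mul_of_nonneg_left (add_le_add le_rfl ?_) (by positivity)
  refine (integral_abs_rpow_le hp.le hmY hf').trans (mul_le_mul_of_nonneg_right ?_ hJ)
  exact Real.rpow_le_rpow (by linarith) hN (by linarith)

lemma setIntegral_rpow_abs_le_of_deriv {p a m N : ℝ} (hp : 1 < p) (ham : a ≤ m)
    (hmN : m ≤ a + N) (hN : 0 < N) {f fx fy : ℝ × ℝ → ℝ} (hf : HasContPartials f fx fy) :
    ∫ z in Icc (0 : ℝ) 1 ×ˢ Icc (a + N) (a + 2 * N), |f z| ^ p ≤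
      2 ^ p * (N * (∫ x in (0 : ℝ)..1, |f (x, m)| ^ p) + N * (2 * N) ^ (p - 1) *
        ∫ z in Icc (0 : ℝ) 1 ×ˢ Icc m (a + 2 * N), |fy z| ^ p) := by
  have hp0 : 0 ≤ p := by linarith
  have cf : Continuous fun z => |f z| ^ p := hf.cont.abs.rpow_const fun _ => Or.inr hp0
  have cy : Continuous fun z => |fy z| ^ p := hf.cont_snd.abs.rpow_const fun _ => Or.inr hp0
  have cJ : Continuous fun x => ∫ s in m..(a + 2 * N), |fy (x, s)| ^ p :=
    intervalIntegral.continuous_parametric_intervalIntegral_of_continuous' (by fun_prop) _ _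
  have c1 : Continuous fun x : ℝ => |f (x, m)| ^ p :=
    cf.comp (by fun_prop : Continuous fun x : ℝ => (x, m))
  set H : ℝ → ℝ := fun x => 2 ^ p * (|f (x, m)| ^ p + (2 * N) ^ (p - 1) *
    ∫ s in m..(a + 2 * N), |fy (x, s)| ^ p) with hH
  have cH : Continuous H := by fun_prop
  have h1 : ∫ z in Icc (0 : ℝ) 1 ×ˢ Icc (a + N) (a + 2 * N), |f z| ^ p ≤
      ∫ z in Icc (0 : ℝ) 1 ×ˢ Icc (a + N) (a + 2 * N), H z.1 := by
    refine setIntegral_mono_on cf.integrableOn_box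
      (cH.comp continuous_fst).integrableOn_box (measurableSet_Icc.prod measurableSet_Icc)
      fun z hz => ?_
    exact rpow_abs_le_of_deriv (f := fun s => f (z.1, s)) (f' := fun s => fy (z.1, s)) hp
      (by linarith) (hmN.trans hz.2.1) hz.2.2 (by linarith) (fun s => hf.deriv_snd z.1 s)
      (hf.cont_snd.comp (by fun_prop))
  refine h1.trans (le_of_eq ?_)
  rw [setIntegral_box_eq_iterated (by linarith) (by fun_prop),
    setIntegral_box_eq_iterated (by linarith) cy]
  simp only [intervalIntegral.integral_const, smul_eq_mul, hH]
  rw [intervalIntegral.integral_const_mul, intervalIntegral.integral_const_mul,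
    intervalIntegral.integral_add (c1.intervalIntegrable _ _)
    ((cJ.const_mul _).intervalIntegrable _ _), intervalIntegral.integral_const_mul]
  ring

lemma tendsto_setIntegral_strip {a : ℝ} {g : ℝ × ℝ → ℝ}
    (hg : IntegrableOn g (Icc (0 : ℝ) 1 ×ˢ Ici a)) :
    Tendsto (fun n : ℕ => ∫ z in Icc (0 : ℝ) 1 ×ˢ Ici (a + n), g z) atTop (𝓝 0) := by
  have hanti : Antitone fun n : ℕ => Icc (0 : ℝ) 1 ×ˢ Ici (a + n) := fun n m hnm =>
    prod_mono_right (Ici_subset_Ici.2 (by gcongr))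
  have h := tendsto_setIntegral_of_antitone (μ := volume) (f := g)
    (fun n : ℕ => (measurableSet_Icc.prod measurableSet_Ici :
      MeasurableSet (Icc (0 : ℝ) 1 ×ˢ Ici (a + n)))) hanti ⟨0, by simpa using hg⟩
  have hemp : ⋂ n : ℕ, Icc (0 : ℝ) 1 ×ˢ Ici (a + n) = ∅ := by
    refine eq_empty_of_forall_notMem fun z hz => ?_
    obtain ⟨n, hn⟩ := exists_nat_gt (z.2 - a)
    have := (mem_iInter.1 hz n).2
    simp only [mem_Ici] at this
    linarith
  rwa [hemp, setIntegral_empty] at h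

/-- The `p`-growth of a function with `p`-integrable vertical derivative is sublinear in mean. -/
lemma tendsto_rpow_neg_mul_setIntegral {p a : ℝ} (hp : 1 < p) {f fx fy : ℝ × ℝ → ℝ}
    (hf : HasContPartials f fx fy)
    (h_int : IntegrableOn (fun z => |fy z| ^ p) (Icc (0 : ℝ) 1 ×ˢ Ici a)) :
    Tendsto (fun n : ℕ => (n : ℝ) ^ (-p) *
      ∫ z in Icc (0 : ℝ) 1 ×ˢ Icc (a + n) (a + 2 * n), |f z| ^ p) atTop (𝓝 0) := by
  have hnn : ∀ (g : ℝ × ℝ → ℝ) (s : Set (ℝ × ℝ)), 0 ≤ ∫ z in s, |g z| ^ p := fun g s =>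
    integral_nonneg fun z => Real.rpow_nonneg (abs_nonneg _) _
  refine tendsto_order.2 ⟨fun ε hε => Eventually.of_forall fun n => hε.trans_le
    (mul_nonneg (by positivity) (hnn _ _)), fun ε hε => ?_⟩
  have hτ := (tendsto_setIntegral_strip h_int).const_mul (2 ^ p * 2 ^ (p - 1))
  rw [mul_zero] at hτ
  obtain ⟨k, hk⟩ := ((tendsto_order.1 hτ).2 (ε / 2) (half_pos hε)).exists
  set A := ∫ x in (0 : ℝ)..1, |f (x, a + k)| ^ p
  set T := ∫ z in Icc (0 : ℝ) 1 ×ˢ Ici (a + k), |fy z| ^ p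
  have hA : Tendsto (fun n : ℕ => 2 ^ p * A * (n : ℝ) ^ (-(p - 1))) atTop (𝓝 0) := by
    have := ((tendsto_rpow_neg_atTop (sub_pos.2 hp)).comp
      tendsto_natCast_atTop_atTop).const_mul (2 ^ p * A)
    rwa [mul_zero] at this
  filter_upwards [(tendsto_order.1 hA).2 (ε / 2) (half_pos hε), eventually_ge_atTop k,
    eventually_ge_atTop 1] with n hn hkn h1n
  have hn0 : (0 : ℝ) < n := by exact_mod_cast h1n
  have hkn' : (k : ℝ) ≤ n := by exact_mod_cast hkn
  have hb := setIntegral_rpow_abs_le_of_deriv (a := a) (m := a + k) (N := n) hp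
    (by linarith [(Nat.cast_nonneg k : (0 : ℝ) ≤ k)]) (by linarith) hn0 hf
  have hT : ∫ z in Icc (0 : ℝ) 1 ×ˢ Icc (a + k) (a + 2 * n), |fy z| ^ p ≤ T :=
    setIntegral_mono_set
      (h_int.mono_set (prod_mono_right (Ici_subset_Ici.2 (by simp))))
      (Eventually.of_forall fun z => Real.rpow_nonneg (abs_nonneg _) _)
      (prod_mono_right Icc_subset_Ici_self).eventuallyLE
  have e1 : (n : ℝ) ^ (-p) * n = (n : ℝ) ^ (-(p - 1)) := by
    rw [← Real.rpow_add_one hn0.ne']; congr 1; ring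
  have e2 : (n : ℝ) ^ (-(p - 1)) * (2 * n) ^ (p - 1) = 2 ^ (p - 1) := by
    rw [Real.mul_rpow (by norm_num) hn0.le, Real.rpow_neg hn0.le]
    have : (n : ℝ) ^ (p - 1) ≠ 0 := (Real.rpow_pos_of_pos hn0 _).ne'
    field_simp
  calc (n : ℝ) ^ (-p) * ∫ z in Icc (0 : ℝ) 1 ×ˢ Icc (a + n) (a + 2 * n), |f z| ^ p
      ≤ (n : ℝ) ^ (-p) * (2 ^ p * (n * A + n * (2 * n) ^ (p - 1) * T)) := by
        refine mul_le_mul_of_nonneg_left (hb.trans ?_) (by positivity)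
        gcongr
    _ = 2 ^ p * A * ((n : ℝ) ^ (-p) * n) +
        2 ^ p * (((n : ℝ) ^ (-p) * n) * (2 * n) ^ (p - 1)) * T := by ring
    _ = 2 ^ p * A * (n : ℝ) ^ (-(p - 1)) + 2 ^ p * 2 ^ (p - 1) * T := by rw [e1, e2]
    _ < ε := by linarith

lemma deriv_smoothTransition_eq_zero {t : ℝ} (ht : t ∉ Ioo (0 : ℝ) 1) :
    deriv Real.smoothTransition t = 0 := by
  rw [mem_Ioo, not_and_or, not_lt, not_lt] at ht
  rcases ht with h | h
  · refine IsLocalMin.deriv_eq_zero (Eventually.of_forall fun s => ?_)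
    rw [Real.smoothTransition.zero_of_nonpos h]
    exact Real.smoothTransition.nonneg s
  · refine IsLocalMax.deriv_eq_zero (Eventually.of_forall fun s => ?_)
    rw [Real.smoothTransition.one_of_one_le h]
    exact Real.smoothTransition.le_one s

/-- A `C¹` cutoff equal to `1` below `a + N` and to `0` above `a + 2 * N`. -/
lemma exists_cutoff : ∃ D : ℝ, 0 ≤ D ∧ ∀ a N : ℝ, 0 < N → ∃ χ χ' : ℝ → ℝ, Continuous χ' ∧
    (∀ y, HasDerivAt χ (χ' y) y) ∧ (∀ y, |χ y| ≤ 1) ∧ (∀ y ≤ a + N, χ y = 1) ∧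
    (∀ y, a + 2 * N ≤ y → χ y = 0) ∧ (∀ y, |χ' y| ≤ D / N) ∧
    ∀ y, y ∉ Icc (a + N) (a + 2 * N) → χ' y = 0 := by
  have hsm : ContDiff ℝ 1 Real.smoothTransition := Real.smoothTransition.contDiff
  have hc : Continuous (deriv Real.smoothTransition) := hsm.continuous_deriv le_rfl
  obtain ⟨D, hD⟩ := (isCompact_Icc (a := (0 : ℝ)) (b := 1)).exists_bound_of_continuousOn
    hc.continuousOn
  have hD0 : 0 ≤ D := (norm_nonneg _).trans (hD 0 (by simp))
  have hDt : ∀ t, |deriv Real.smoothTransition t| ≤ D := fun t => by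
    by_cases ht : t ∈ Ioo (0 : ℝ) 1
    · exact hD t (Ioo_subset_Icc_self ht)
    · rwa [deriv_smoothTransition_eq_zero ht, abs_zero]
  refine ⟨D, hD0, fun a N hN => ⟨fun y => Real.smoothTransition (2 - (y - a) / N),
    fun y => deriv Real.smoothTransition (2 - (y - a) / N) * (-(1 / N)), by fun_prop,
    fun y => ?_, fun y => ?_, fun y hy => ?_, fun y hy => ?_, fun y => ?_, fun y hy => ?_⟩⟩
  · have h1 : HasDerivAt (fun y => 2 - (y - a) / N) (-(1 / N)) y :=
      (((hasDerivAt_id y).sub_const a).div_const N).const_sub 2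
    exact ((hsm.differentiable one_ne_zero) _).hasDerivAt.comp y h1
  · rw [abs_of_nonneg (Real.smoothTransition.nonneg _)]
    exact Real.smoothTransition.le_one _
  · refine Real.smoothTransition.one_of_one_le ?_
    have : (y - a) / N ≤ 1 := (div_le_one hN).2 (by linarith)
    linarith
  · refine Real.smoothTransition.zero_of_nonpos ?_
    have : 2 ≤ (y - a) / N := (le_div_iff₀ hN).2 (by linarith)
    linarith
  · rw [abs_mul, abs_neg, abs_of_pos (one_div_pos.2 hN), mul_one_div]
    exact div_le_div_of_nonneg_right (hDt _) hN.le
  · beta_reduce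
    rw [deriv_smoothTransition_eq_zero, zero_mul]
    rintro ⟨h1, h2⟩
    have h3 : (y - a) / N < 2 := by linarith
    have h4 : 1 < (y - a) / N := by linarith
    rw [div_lt_iff₀ hN] at h3
    rw [lt_div_iff₀ hN] at h4
    exact hy ⟨by linarith, by linarith⟩

lemma HasContPartials.cutoff {f fx fy : ℝ × ℝ → ℝ} (hf : HasContPartials f fx fy)
    {χ χ' : ℝ → ℝ} (hχ : ∀ y, HasDerivAt χ (χ' y) y) (hχ' : Continuous χ') :
    HasContPartials (fun z => χ z.2 * f z) (fun z => χ z.2 * fx z)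
      (fun z => χ' z.2 * f z + χ z.2 * fy z) := by
  have cχ : Continuous χ := continuous_iff_continuousAt.2 fun y => (hχ y).continuousAt
  have c0 := hf.cont
  have c1 := hf.cont_fst
  have c2 := hf.cont_snd
  exact ⟨by fun_prop, by fun_prop, by fun_prop, fun x y => (hf.deriv_fst x y).const_mul (χ y),
    fun x y => (hχ y).mul (hf.deriv_snd x y)⟩

lemma setIntegral_cutoff_le {p a N D : ℝ} (hp : 1 < p) (hN : 0 < N) (hD : 0 ≤ D)
    {χ χ' : ℝ → ℝ} (hχ : Continuous χ) (hχ' : Continuous χ') (h1 : ∀ y, |χ y| ≤ 1)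
    (h2 : ∀ y, |χ' y| ≤ D / N) (h3 : ∀ y, y ∉ Icc (a + N) (a + 2 * N) → χ' y = 0)
    {g h : ℝ × ℝ → ℝ} (hg : Continuous g) (hh : Continuous h)
    (h_int : IntegrableOn (fun z => |h z| ^ p) (Icc (0 : ℝ) 1 ×ˢ Ici a)) :
    ∫ z in Icc (0 : ℝ) 1 ×ˢ Icc a (a + 3 * (2 * N)), |χ' z.2 * g z + χ z.2 * h z| ^ p ≤
      2 ^ p * (D ^ p * (N ^ (-p) * ∫ z in Icc (0 : ℝ) 1 ×ˢ Icc (a + N) (a + 2 * N), |g z| ^ p) +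
        ∫ z in Icc (0 : ℝ) 1 ×ˢ Ici a, |h z| ^ p) := by
  have hp0 : 0 < p := by linarith
  have cpow : ∀ {F : ℝ × ℝ → ℝ}, Continuous F → Continuous fun z => |F z| ^ p :=
    fun hF => hF.abs.rpow_const fun _ => Or.inr hp0.le
  have cA : Continuous fun z : ℝ × ℝ => |χ' z.2 * g z| ^ p := cpow (by fun_prop)
  have cB : Continuous fun z : ℝ × ℝ => |h z| ^ p := cpow hh
  have hA : ∫ z in Icc (0 : ℝ) 1 ×ˢ Icc a (a + 3 * (2 * N)), |χ' z.2 * g z| ^ p ≤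
      D ^ p * (N ^ (-p) * ∫ z in Icc (0 : ℝ) 1 ×ˢ Icc (a + N) (a + 2 * N), |g z| ^ p) := by
    rw [setIntegral_eq_of_subset_of_forall_sdiff_eq_zero
      (s := Icc (0 : ℝ) 1 ×ˢ Icc (a + N) (a + 2 * N)) (measurableSet_Icc.prod measurableSet_Icc)
      (prod_mono_right (Icc_subset_Icc (by linarith) (by linarith))) fun z hz => ?_]
    · rw [← mul_assoc, ← integral_const_mul]
      refine setIntegral_mono_on cA.integrableOn_box ((cpow hg).integrableOn_box.const_mul _)
        (measurableSet_Icc.prod measurableSet_Icc) fun z _ => ?_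
      rw [abs_mul, Real.mul_rpow (abs_nonneg _) (abs_nonneg _), Real.rpow_neg hN.le,
        ← div_eq_mul_inv, ← Real.div_rpow hD hN.le]
      exact mul_le_mul_of_nonneg_right (Real.rpow_le_rpow (abs_nonneg _) (h2 _) hp0.le)
        (Real.rpow_nonneg (abs_nonneg _) _)
    · rw [h3 z.2 fun hz2 => hz.2 ⟨hz.1.1, hz2⟩, zero_mul, abs_zero, Real.zero_rpow hp0.ne']
  have hB : ∫ z in Icc (0 : ℝ) 1 ×ˢ Icc a (a + 3 * (2 * N)), |h z| ^ p ≤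
      ∫ z in Icc (0 : ℝ) 1 ×ˢ Ici a, |h z| ^ p :=
    setIntegral_mono_set h_int (Eventually.of_forall fun z => Real.rpow_nonneg (abs_nonneg _) _)
      (prod_mono_right Icc_subset_Ici_self).eventuallyLE
  calc _ ≤ ∫ z in Icc (0 : ℝ) 1 ×ˢ Icc a (a + 3 * (2 * N)),
        2 ^ p * (|χ' z.2 * g z| ^ p + |h z| ^ p) := by
        refine setIntegral_mono_on (cpow (by fun_prop)).integrableOn_box
          (by fun_prop : Continuous fun z : ℝ × ℝ =>
            2 ^ p * (|χ' z.2 * g z| ^ p + |h z| ^ p)).integrableOn_box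
          (measurableSet_Icc.prod measurableSet_Icc) fun z _ => ?_
        refine (Real.rpow_le_rpow (abs_nonneg _) ?_ hp0.le).trans
          (add_rpow_le_two_rpow_mul hp0 (abs_nonneg _) (abs_nonneg _))
        refine (abs_add_le _ _).trans (add_le_add le_rfl ?_)
        rw [abs_mul]
        exact mul_le_of_le_one_left (abs_nonneg _) (h1 _)
    _ = 2 ^ p * ((∫ z in Icc (0 : ℝ) 1 ×ˢ Icc a (a + 3 * (2 * N)), |χ' z.2 * g z| ^ p) +
        ∫ z in Icc (0 : ℝ) 1 ×ˢ Icc a (a + 3 * (2 * N)), |h z| ^ p) := by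
        rw [integral_const_mul, integral_add cA.integrableOn_box cB.integrableOn_box]
    _ ≤ _ := by gcongr

lemma setIntegral_strip_le_of_forall_nat {a B : ℝ} {g : ℝ × ℝ → ℝ} (hB : 0 ≤ B)
    (h : ∀ n : ℕ, ∫ z in Icc (0 : ℝ) 1 ×ˢ Icc a (a + n), g z ≤ B) :
    ∫ z in Icc (0 : ℝ) 1 ×ˢ Ici a, g z ≤ B := by
  by_cases hg : IntegrableOn g (Icc (0 : ℝ) 1 ×ˢ Ici a)
  · have hmono : Monotone fun n : ℕ => Icc (0 : ℝ) 1 ×ˢ Icc a (a + n) := fun n m hnm =>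
      prod_mono_right (Icc_subset_Icc_right (by gcongr))
    have hU : ⋃ n : ℕ, Icc (0 : ℝ) 1 ×ˢ Icc a (a + n) = Icc (0 : ℝ) 1 ×ˢ Ici a := by
      refine subset_antisymm (iUnion_subset fun n => prod_mono_right Icc_subset_Ici_self)
        fun z hz => ?_
      obtain ⟨n, hn⟩ := exists_nat_ge (z.2 - a)
      exact mem_iUnion.2 ⟨n, hz.1, hz.2, by linarith⟩
    have ht := tendsto_setIntegral_of_monotone (μ := volume) (f := g)
      (fun n : ℕ => (measurableSet_Icc.prod measurableSet_Icc :
        MeasurableSet (Icc (0 : ℝ) 1 ×ˢ Icc a (a + n)))) hmono (by rwa [hU])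
    rw [hU] at ht
    exact le_of_tendsto' ht h
  · rw [integral_undef hg]
    exact hB

/-- Korn's inequality on the half-strip: the curl is controlled by the symmetric gradient. -/
lemma exists_korn_half_strip {p : ℝ} (hp : 1 < p) :
    ∃ K : ℝ, 0 < K ∧ ∀ (a : ℝ) (u₁ u₂ u₁x u₁y u₂x u₂y : ℝ × ℝ → ℝ),
      HasContPartials u₁ u₁x u₁y → HasContPartials u₂ u₂x u₂y →
      (∀ y, u₁ (0, y) = u₁ (1, y)) → (∀ y, u₂ (0, y) = u₂ (1, y)) →
      IntegrableOn (fun z => |u₁x z| ^ p) (Icc (0 : ℝ) 1 ×ˢ Ici a) →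
      IntegrableOn (fun z => |u₁y z| ^ p) (Icc (0 : ℝ) 1 ×ˢ Ici a) →
      IntegrableOn (fun z => |u₂y z| ^ p) (Icc (0 : ℝ) 1 ×ˢ Ici a) →
      IntegrableOn (fun z => |u₁y z + u₂x z| ^ p) (Icc (0 : ℝ) 1 ×ˢ Ici a) →
      ∫ z in Icc (0 : ℝ) 1 ×ˢ Ici a, |u₂x z - u₁y z| ^ p ≤
        K * ((∫ z in Icc (0 : ℝ) 1 ×ˢ Ici a, |u₁x z| ^ p) +
          (∫ z in Icc (0 : ℝ) 1 ×ˢ Ici a, |u₂y z| ^ p) +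
          ∫ z in Icc (0 : ℝ) 1 ×ˢ Ici a, |u₁y z + u₂x z| ^ p) := by
  obtain ⟨K, hK, hkorn⟩ := exists_korn_of_vanishing hp
  obtain ⟨D, hD, hcut⟩ := exists_cutoff
  refine ⟨K * 2 ^ p, by positivity, fun a u₁ u₂ u₁x u₁y u₂x u₂y h₁ h₂ hp₁ hp₂ i₁ i₂ i₃ i₄ => ?_⟩
  have hnn : ∀ (g : ℝ × ℝ → ℝ) (s : Set (ℝ × ℝ)), 0 ≤ ∫ z in s, |g z| ^ p := fun g s =>
    integral_nonneg fun z => Real.rpow_nonneg (abs_nonneg _) _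
  have hp0 : 0 < p := by linarith
  set E := (∫ z in Icc (0 : ℝ) 1 ×ˢ Ici a, |u₁x z| ^ p) +
          (∫ z in Icc (0 : ℝ) 1 ×ˢ Ici a, |u₂y z| ^ p) +
          ∫ z in Icc (0 : ℝ) 1 ×ˢ Ici a, |u₁y z + u₂x z| ^ p with hE
  have hE0 : 0 ≤ E := add_nonneg (add_nonneg (hnn _ _) (hnn _ _)) (hnn _ _)
  have cx₁ := h₁.cont_fst
  have cy₁ := h₁.cont_snd
  have cx₂ := h₂.cont_fst
  have cy₂ := h₂.cont_snd
  have cw : Continuous fun z => |u₂x z - u₁y z| ^ p :=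
    (cx₂.sub cy₁).abs.rpow_const fun _ => Or.inr hp0.le
  set R₁ : ℕ → ℝ := fun n => (n : ℝ) ^ (-p) *
    ∫ z in Icc (0 : ℝ) 1 ×ˢ Icc (a + n) (a + 2 * n), |u₁ z| ^ p with hR₁
  set R₂ : ℕ → ℝ := fun n => (n : ℝ) ^ (-p) *
    ∫ z in Icc (0 : ℝ) 1 ×ˢ Icc (a + n) (a + 2 * n), |u₂ z| ^ p with hR₂
  have hbound : ∀ n : ℕ, 1 ≤ n → ∫ z in Icc (0 : ℝ) 1 ×ˢ Icc a (a + n), |u₂x z - u₁y z| ^ p ≤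
      K * 2 ^ p * (D ^ p * (R₁ n + R₂ n) + E) := by
    intro n hn
    have hN : (0 : ℝ) < n := by exact_mod_cast hn
    obtain ⟨χ, χ', cχ', dχ, bχ, χ1, χ0, bχ', zχ'⟩ := hcut a n hN
    have cχ : Continuous χ := continuous_iff_continuousAt.2 fun y => (dχ y).continuousAt
    have hv := hkorn a (2 * n) _ _ _ _ _ _ (by linarith) (h₁.cutoff dχ cχ') (h₂.cutoff dχ cχ')
      (fun y => by simp only [hp₁]) (fun y => by simp only [hp₂])
      (fun x y hy => by simp only [χ0 y hy, zero_mul])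
      (fun x y hy => by simp only [χ0 y hy, zero_mul])
    have e₁ := setIntegral_cutoff_le hp hN hD cχ cχ' bχ bχ' zχ'
      (continuous_const : Continuous fun _ : ℝ × ℝ => (0 : ℝ)) cx₁ i₁
    have e₂ := setIntegral_cutoff_le hp hN hD cχ cχ' bχ bχ' zχ' h₂.cont cy₂ i₃
    have e₃ := setIntegral_cutoff_le hp hN hD cχ cχ' bχ bχ' zχ'
      (h := fun z => u₁y z + u₂x z) h₁.cont (cy₁.add cx₂) i₄
    simp only [mul_zero, zero_add, abs_zero, Real.zero_rpow hp0.ne', integral_zero] at e₁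
    have e₃' : ∫ z in Icc (0 : ℝ) 1 ×ˢ Icc a (a + 3 * (2 * n)),
        |χ' z.2 * u₁ z + χ z.2 * u₁y z + χ z.2 * u₂x z| ^ p =
        ∫ z in Icc (0 : ℝ) 1 ×ˢ Icc a (a + 3 * (2 * n)),
        |χ' z.2 * u₁ z + χ z.2 * (u₁y z + u₂x z)| ^ p := by
      simp only [mul_add, add_assoc]
    have hlhs : ∫ z in Icc (0 : ℝ) 1 ×ˢ Icc a (a + n), |u₂x z - u₁y z| ^ p ≤
        ∫ z in Icc (0 : ℝ) 1 ×ˢ Icc a (a + 2 * n),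
          |χ z.2 * u₂x z - (χ' z.2 * u₁ z + χ z.2 * u₁y z)| ^ p := by
      have c₁ := h₁.cont
      have cv : Continuous fun z : ℝ × ℝ =>
          |χ z.2 * u₂x z - (χ' z.2 * u₁ z + χ z.2 * u₁y z)| ^ p :=
        (by fun_prop : Continuous fun z : ℝ × ℝ =>
          |χ z.2 * u₂x z - (χ' z.2 * u₁ z + χ z.2 * u₁y z)|).rpow_const fun _ => Or.inr hp0.le
      refine le_trans (le_of_eq ?_) (setIntegral_mono_set cv.integrableOn_box
        (Eventually.of_forall fun z => Real.rpow_nonneg (abs_nonneg _) _)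
        (prod_mono_right (Icc_subset_Icc_right (by linarith :
          a + n ≤ a + 2 * n))).eventuallyLE)
      rw [restrict_box_eq]
      refine setIntegral_congr_fun (measurableSet_Ioo.prod measurableSet_Ioo) fun z hz => ?_
      simp only [χ1 z.2 hz.2.2.le, zχ' z.2 fun h => absurd h.1 (not_le.2 hz.2.2), one_mul, zero_mul,
        zero_add]
    refine hlhs.trans (hv.trans ?_)
    rw [mul_assoc K]
    refine mul_le_mul_of_nonneg_left ?_ hK.le
    rw [e₃']
    refine (add_le_add (add_le_add e₁ e₂) e₃).trans (le_of_eq ?_)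
    simp only [hE, hR₁, hR₂]
    ring
  have hlim : Tendsto (fun n : ℕ => K * 2 ^ p * (D ^ p * (R₁ n + R₂ n) + E)) atTop
      (𝓝 (K * 2 ^ p * E)) := by
    have := ((((tendsto_rpow_neg_mul_setIntegral hp h₁ i₂).add
      (tendsto_rpow_neg_mul_setIntegral hp h₂ i₃)).const_mul (D ^ p)).add_const E).const_mul
      (K * 2 ^ p)
    rwa [add_zero, mul_zero, zero_add] at this
  refine setIntegral_strip_le_of_forall_nat (by positivity) fun m => ?_
  refine ge_of_tendsto hlim ?_
  filter_upwards [eventually_ge_atTop m, eventually_ge_atTop 1] with n hmn h1n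
  refine le_trans (setIntegral_mono_set cw.integrableOn_box
    (Eventually.of_forall fun z => Real.rpow_nonneg (abs_nonneg _) _)
    (prod_mono_right (Icc_subset_Icc_right ?_)).eventuallyLE) (hbound n h1n)
  gcongr

lemma restrict_strip_eq (a : ℝ) : (volume : Measure (ℝ × ℝ)).restrict (Ioo 0 1 ×ˢ Ioi a) =
    volume.restrict (Icc 0 1 ×ˢ Ici a) := by
  rw [Measure.volume_eq_prod, ← Measure.prod_restrict, ← Measure.prod_restrict,
    Measure.restrict_congr_set Ioo_ae_eq_Icc, Measure.restrict_congr_set Ioi_ae_eq_Ici]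

lemma hasContPartials_of_contDiff {f : ℝ × ℝ → ℝ} (hf : ContDiff ℝ 1 f) :
    HasContPartials f (fun z => fderiv ℝ f z (1, 0)) fun z => fderiv ℝ f z (0, 1) := by
  have hc := hf.continuous_fderiv one_ne_zero
  have hd : ∀ z, HasFDerivAt f (fderiv ℝ f z) z := fun z =>
    (hf.differentiable one_ne_zero z).hasFDerivAt
  exact ⟨hf.continuous, hc.clm_apply continuous_const, hc.clm_apply continuous_const,
    fun x y => (hd (x, y)).comp_hasDerivAt x ((hasDerivAt_id x).prodMk (hasDerivAt_const x y)),
    fun x y => (hd (x, y)).comp_hasDerivAt y ((hasDerivAt_const y x).prodMk (hasDerivAt_id y))⟩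

lemma symPart_apply (A : Matrix (Fin 2) (Fin 2) ℝ) (i j : Fin 2) :
    symPart A i j = (A i j + A j i) / 2 := by
  simp only [symPart, Matrix.smul_apply, Matrix.add_apply, transpose_apply, smul_eq_mul]
  ring

lemma frobNorm_nonneg (A : Matrix (Fin 2) (Fin 2) ℝ) : 0 ≤ frobNorm A := Real.sqrt_nonneg _

lemma abs_apply_le_frobNorm (A : Matrix (Fin 2) (Fin 2) ℝ) (i j : Fin 2) :
    |A i j| ≤ frobNorm A := by
  refine Real.abs_le_sqrt ?_
  exact (Finset.single_le_sum (f := fun j => A i j ^ 2) (fun j _ => sq_nonneg _)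
    (Finset.mem_univ j)).trans (Finset.single_le_sum (f := fun i => ∑ j, A i j ^ 2)
      (fun i _ => Finset.sum_nonneg fun j _ => sq_nonneg _) (Finset.mem_univ i))

lemma continuous_frobNorm : Continuous frobNorm :=
  Real.continuous_sqrt.comp (by fun_prop)

lemma frobNorm_symPart_le (A : Matrix (Fin 2) (Fin 2) ℝ) : frobNorm (symPart A) ≤ frobNorm A := by
  refine Real.sqrt_le_sqrt ?_
  simp only [Fin.sum_univ_two, symPart_apply]
  nlinarith [sq_nonneg (A 0 1 - A 1 0)]

lemma frobNorm_le_abs_curl_add (A : Matrix (Fin 2) (Fin 2) ℝ) :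
    frobNorm A ≤ |A 1 0 - A 0 1| + frobNorm (symPart A) := by
  have hS : frobNorm (symPart A) ^ 2 = A 0 0 ^ 2 + A 1 1 ^ 2 + (A 0 1 + A 1 0) ^ 2 / 2 := by
    rw [frobNorm, Real.sq_sqrt (by positivity)]
    simp only [Fin.sum_univ_two, symPart_apply]
    ring
  refine Real.sqrt_le_iff.2 ⟨add_nonneg (abs_nonneg _) (frobNorm_nonneg _), ?_⟩
  have h := mul_nonneg (abs_nonneg (A 1 0 - A 0 1)) (frobNorm_nonneg (symPart A))
  rw [add_sq, hS, sq_abs]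
  simp only [Fin.sum_univ_two]
  nlinarith [sq_nonneg (A 1 0 - A 0 1)]

end Preliminaries

/-- Homogeneous Korn inequality on the periodic half-strip `H_a = (0,1) × (a, ∞)`:
there is `C = C(p) > 0` (independent of `a`) with
`∫_{H_a} ‖∇u‖_F^p ≤ C ∫_{H_a} ‖Du‖_F^p` for every `C¹` map `u` 1-periodic in `y₁`
whose gradient is `p`-integrable on `H_a`. -/
theorem korn_inequality_periodic_half_strip (p : ℝ) (hp : 1 < p) :
    ∃ C : ℝ, 0 < C ∧ ∀ (a : ℝ) (u : ℝ × ℝ → ℝ × ℝ), ContDiff ℝ 1 u →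
      (∀ y : ℝ × ℝ, u (y.1 + 1, y.2) = u y) →
      IntegrableOn (fun y => frobNorm (jacMat u y) ^ p)
        (Set.Ioo (0:ℝ) 1 ×ˢ Set.Ioi a) volume →
      (∫ y in Set.Ioo (0:ℝ) 1 ×ˢ Set.Ioi a, frobNorm (jacMat u y) ^ p) ≤
        C * ∫ y in Set.Ioo (0:ℝ) 1 ×ˢ Set.Ioi a,
          frobNorm (symPart (jacMat u y)) ^ p := by
  have hp0 : 0 < p := by linarith
  obtain ⟨K, hK, hkorn⟩ := exists_korn_half_strip hp
  refine ⟨2 ^ p * (K * (2 + 2 ^ p) + 1), by positivity, fun a u hu hper h_int => ?_⟩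
  rw [IntegrableOn, restrict_strip_eq] at h_int
  rw [restrict_strip_eq]
  set S : Set (ℝ × ℝ) := Set.Icc 0 1 ×ˢ Set.Ici a
  have h₁ := hasContPartials_of_contDiff hu.fst
  have h₂ := hasContPartials_of_contDiff hu.snd
  have hdu : ∀ z, DifferentiableAt ℝ u z := hu.differentiable one_ne_zero
  have f₁ : ∀ z v, fderiv ℝ (fun z => (u z).1) z v = (fderiv ℝ u z v).1 := fun z v => by
    rw [fderiv.fst (hdu z)]; rfl
  have f₂ : ∀ z v, fderiv ℝ (fun z => (u z).2) z v = (fderiv ℝ u z v).2 := fun z v => by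
    rw [fderiv.snd (hdu z)]; rfl
  simp only [f₁] at h₁
  simp only [f₂] at h₂
  set J : ℝ × ℝ → Matrix (Fin 2) (Fin 2) ℝ := jacMat u with hJ
  have j00 : ∀ z, (fderiv ℝ u z (1, 0)).1 = J z 0 0 := fun z => rfl
  have j01 : ∀ z, (fderiv ℝ u z (0, 1)).1 = J z 0 1 := fun z => rfl
  have j10 : ∀ z, (fderiv ℝ u z (1, 0)).2 = J z 1 0 := fun z => rfl
  have j11 : ∀ z, (fderiv ℝ u z (0, 1)).2 = J z 1 1 := fun z => rfl
  simp only [j00, j01] at h₁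
  simp only [j10, j11] at h₂
  have cJ : Continuous J := by
    refine continuous_matrix fun i j => ?_
    fin_cases i <;> fin_cases j
    exacts [h₁.cont_fst, h₁.cont_snd, h₂.cont_fst, h₂.cont_snd]
  have cS : Continuous fun z => frobNorm (symPart (J z)) := continuous_frobNorm.comp (by
    unfold symPart; fun_prop)
  have iS : IntegrableOn (fun z => frobNorm (symPart (J z)) ^ p) S := by
    refine h_int.mono' (cS.rpow_const fun _ => Or.inr hp0.le).aestronglyMeasurable
      (Filter.Eventually.of_forall fun z => ?_)
    rw [Real.norm_of_nonneg (Real.rpow_nonneg (frobNorm_nonneg _) _)]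
    exact Real.rpow_le_rpow (frobNorm_nonneg _) (frobNorm_symPart_le _) hp0.le
  have hdom : ∀ {g : ℝ × ℝ → ℝ} {G : ℝ × ℝ → ℝ} (c : ℝ), 0 ≤ c → Continuous g →
      (∀ z, 0 ≤ G z) → (∀ z, |g z| ≤ c * G z) → IntegrableOn (fun z => G z ^ p) S →
      IntegrableOn (fun z => |g z| ^ p) S ∧
        ∫ z in S, |g z| ^ p ≤ c ^ p * ∫ z in S, G z ^ p := by
    intro g G c hc hg hG hle hi
    have hle' : ∀ z, |g z| ^ p ≤ c ^ p * G z ^ p := fun z => by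
      rw [← Real.mul_rpow hc (hG z)]
      exact Real.rpow_le_rpow (abs_nonneg _) (hle z) hp0.le
    have h1 : IntegrableOn (fun z => |g z| ^ p) S := by
      refine (hi.const_mul (c ^ p)).mono'
        (hg.abs.rpow_const fun _ => Or.inr hp0.le).aestronglyMeasurable
        (Filter.Eventually.of_forall fun z => ?_)
      rw [Real.norm_of_nonneg (Real.rpow_nonneg (abs_nonneg _) _)]
      exact hle' z
    refine ⟨h1, ?_⟩
    rw [← integral_const_mul]
    exact integral_mono h1 (hi.const_mul _) hle'
  have b₁ := hdom (g := fun z => J z 0 0) 1 zero_le_one h₁.cont_fst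
    (fun z => frobNorm_nonneg (symPart (J z))) (fun z => by
      have := abs_apply_le_frobNorm (symPart (J z)) 0 0
      rwa [symPart_apply, add_self_div_two, ← one_mul (frobNorm _)] at this) iS
  have b₂ := hdom (g := fun z => J z 1 1) 1 zero_le_one h₂.cont_snd
    (fun z => frobNorm_nonneg (symPart (J z))) (fun z => by
      have := abs_apply_le_frobNorm (symPart (J z)) 1 1
      rwa [symPart_apply, add_self_div_two, ← one_mul (frobNorm _)] at this) iS
  have b₃ := hdom (g := fun z => J z 0 1 + J z 1 0) 2 zero_le_two
    (h₁.cont_snd.add h₂.cont_fst) (fun z => frobNorm_nonneg (symPart (J z))) (fun z => by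
      have := abs_apply_le_frobNorm (symPart (J z)) 0 1
      rw [symPart_apply, abs_div, abs_two] at this
      linarith) iS
  have b₄ := hdom (g := fun z => J z 0 1) 1 zero_le_one h₁.cont_snd
    (fun z => frobNorm_nonneg (J z)) (fun z => by
      rw [one_mul]; exact abs_apply_le_frobNorm (J z) 0 1) h_int
  have b₅ := hdom (g := fun z => J z 1 0 - J z 0 1) 2 zero_le_two
    (h₂.cont_fst.sub h₁.cont_snd) (fun z => frobNorm_nonneg (J z)) (fun z => by
      have := abs_sub (J z 1 0) (J z 0 1)
      linarith [abs_apply_le_frobNorm (J z) 0 1, abs_apply_le_frobNorm (J z) 1 0]) h_int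
  have hw := hkorn a _ _ _ _ _ _ h₁ h₂
    (fun y => by have := hper (0, y); rw [zero_add] at this; rw [this])
    (fun y => by have := hper (0, y); rw [zero_add] at this; rw [this]) b₁.1 b₄.1 b₂.1 b₃.1
  set I := ∫ z in S, frobNorm (symPart (J z)) ^ p
  have hw' : ∫ z in S, |J z 1 0 - J z 0 1| ^ p ≤ K * ((2 + 2 ^ p) * I) := by
    refine hw.trans (mul_le_mul_of_nonneg_left ?_ hK.le)
    have e₁ := b₁.2
    have e₂ := b₂.2
    rw [Real.one_rpow, one_mul] at e₁ e₂
    linarith [b₃.2]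
  calc ∫ z in S, frobNorm (J z) ^ p
      ≤ ∫ z in S, 2 ^ p * (|J z 1 0 - J z 0 1| ^ p + frobNorm (symPart (J z)) ^ p) :=
        integral_mono h_int ((b₅.1.add iS).const_mul _) fun z =>
          (Real.rpow_le_rpow (frobNorm_nonneg _) (frobNorm_le_abs_curl_add _) hp0.le).trans
            (add_rpow_le_two_rpow_mul hp0 (abs_nonneg _) (frobNorm_nonneg _))
    _ = 2 ^ p * ((∫ z in S, |J z 1 0 - J z 0 1| ^ p) + I) := by
        rw [integral_const_mul, integral_add b₅.1 iS]
    _ ≤ 2 ^ p * (K * ((2 + 2 ^ p) * I) + I) := by gcongr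
    _ = 2 ^ p * (K * (2 + 2 ^ p) + 1) * I := by ring
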